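/- arXiv:1410.8838 — 3 statements merged into one kernel-verified Lean document; each statement's English description precedes it below -/
import Mathlib

section
/- Let B be the unital K-subalgebra of T = ∏_{i=1}^∞ M_i(K) generated by w, w*, and the inverses f(w)^{-1} for all f ∈ Σ, and let I and J be the two-sided ideals of B generated by 1 − w·w* and by 1 − w*·w, respectively. Then I·J = ⊕_{i=1}^∞ M_i(K) and ⊕_{i=1}^∞ M_i(K) ⊆ J·I, where I·J denotes the set of finite sums of products x·y with x ∈ I and y ∈ J. -/
set_option synthInstance.maxHeartbeats 1000000
set_option maxHeartbeats 1000000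

namespace ShiftProduct

/-- `T = ∏_{i=1}^∞ M_i(K)`; the index `n : ℕ` corresponds to the factor `M_{n+1}(K)`. -/
abbrev TProd (K : Type*) [Field K] : Type _ :=
  ∀ n : ℕ, Matrix (Fin (n + 1)) (Fin (n + 1)) K

/-- the element `w = (w_i)_i ∈ T`, where `w_i` is the lower shift matrix of size `i`. -/
def wT (K : Type*) [Field K] : TProd K :=
  fun n => Matrix.of fun (a b : Fin (n + 1)) => if (a : ℕ) = (b : ℕ) + 1 then (1 : K) else 0

/-- the element `w* ∈ T`, the componentwise transpose of `w`. -/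
def wstarT (K : Type*) [Field K] : TProd K :=
  fun n => (wT K n).transpose

/-- `⊕_{i=1}^∞ M_i(K)`, the ideal of sequences with finitely many nonzero components. -/
def socSet (K : Type*) [Field K] : Set (TProd K) :=
  {x | ∃ N : ℕ, ∀ n : ℕ, N ≤ n → x n = 0}

/-- the unital `K`-subalgebra of `T` generated by `w` and `w*`
(the image of the semigroup algebra `K[𝓕]` of the monogenic free inverse monoid). -/
def B0 (K : Type*) [Field K] : Subalgebra K (TProd K) :=
  Algebra.adjoin K {wT K, wstarT K}

end ShiftProduct

namespace ShiftProduct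

open Polynomial

/-- the unital `K`-subalgebra `B` of `T` generated by `w`, `w*` and the inverses
`f(w)⁻¹` for `f ∈ Σ = {f ∈ K[x] : f(0) = 1}` (these `f(w)` are units of `T`, and
`Ring.inverse` produces their inverses); `B` is the image of the universal localization
`Σ⁻¹ K[𝓕]`. -/
noncomputable def Balg (K : Type*) [Field K] : Subalgebra K (TProd K) :=
  Algebra.adjoin K ({wT K, wstarT K} ∪
    {y : TProd K | ∃ p : K[X], p.coeff 0 = 1 ∧ y = Ring.inverse (aeval (wT K) p)})

end ShiftProduct

namespace ShiftProduct

variable {K : Type*} [Field K]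

lemma wT_pow_apply (k n : ℕ) (a b : Fin (n + 1)) :
    (wT K ^ k) n a b = if (a : ℕ) = b + k then 1 else 0 := by
  induction k generalizing b with
  | zero => simp [Matrix.one_apply, Fin.ext_iff]
  | succ k ih =>
    rw [pow_succ, Pi.mul_apply, Matrix.mul_apply]
    simp_rw [ih, wT, Matrix.of_apply]
    by_cases h : (b : ℕ) + 1 < n + 1
    · rw [Finset.sum_eq_single (⟨b + 1, h⟩ : Fin (n + 1))]
      · simp only [if_true, mul_one]
        congr 1
        simp only [eq_iff_iff]
        omega
      · intro c _ hc
        rw [if_neg (c := (c : ℕ) = b + 1) (fun hh => hc (Fin.ext hh)), mul_zero]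
      · simp
    · rw [if_neg (by omega)]
      refine Finset.sum_eq_zero fun c _ => ?_
      rw [if_neg (c := (c : ℕ) = b + 1) (by omega), mul_zero]

lemma wstarT_pow_apply (k n : ℕ) (a b : Fin (n + 1)) :
    (wstarT K ^ k) n a b = if (b : ℕ) = a + k then 1 else 0 := by
  have h : (wstarT K ^ k) n = ((wT K ^ k) n).transpose := by
    simp [wstarT, Matrix.transpose_pow]
  rw [h, Matrix.transpose_apply, wT_pow_apply]

lemma one_sub_wT_mul_wstarT (n : ℕ) :
    (1 - wT K * wstarT K) n = Matrix.single 0 0 1 := by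
  ext a b
  rw [Pi.sub_apply, Matrix.sub_apply, Pi.mul_apply, Matrix.mul_apply]
  simp only [Pi.one_apply, Matrix.one_apply, wstarT, wT, Matrix.transpose_apply, Matrix.of_apply,
    Matrix.single_apply]
  by_cases ha : (a : ℕ) = 0
  · have ha' : a = 0 := Fin.ext ha
    subst ha'
    simp
  · have h0 : (0 : Fin (n + 1)) ≠ a := fun h => ha (by simp [← h])
    rw [Finset.sum_eq_single (⟨a - 1, by omega⟩ : Fin (n + 1))]
    · have h1 : (a : ℕ) = a - 1 + 1 := by omega
      simp only [← h1, if_true, one_mul, h0, false_and, if_false]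
      by_cases hab : a = b
      · simp [hab]
      · rw [if_neg hab, if_neg (fun h => hab (Fin.ext h.symm)), sub_zero]
    · intro c _ hc
      rw [if_neg (c := (a : ℕ) = c + 1), zero_mul]
      intro h
      exact hc (Fin.ext (by simp [h]))
    · simp

lemma one_sub_wstarT_mul_wT (n : ℕ) :
    (1 - wstarT K * wT K) n = Matrix.single (Fin.last n) (Fin.last n) 1 := by
  ext a b
  rw [Pi.sub_apply, Matrix.sub_apply, Pi.mul_apply, Matrix.mul_apply]
  simp only [Pi.one_apply, Matrix.one_apply, wstarT, wT, Matrix.transpose_apply, Matrix.of_apply,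
    Matrix.single_apply]
  by_cases ha : (a : ℕ) = n
  · have ha' : a = Fin.last n := Fin.ext ha
    subst ha'
    rw [Finset.sum_eq_zero, sub_zero]
    · simp
    · intro c _
      rw [if_neg, zero_mul]
      simp only [Fin.val_last]
      omega
  · have h0 : Fin.last n ≠ a := fun h => ha (by simp [← h])
    rw [Finset.sum_eq_single (⟨a + 1, by omega⟩ : Fin (n + 1))]
    · simp only [if_true, one_mul, h0, false_and, if_false, add_left_inj]
      by_cases hab : a = b
      · simp [hab]
      · rw [if_neg hab, if_neg (fun h => hab (Fin.ext h)), sub_zero]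
    · intro c _ hc
      rw [if_neg (c := (c : ℕ) = a + 1) (fun h => hc (Fin.ext h)), zero_mul]
    · simp

/-- The elements of `T` whose components have uniformly bounded upper bandwidth. -/
def boundedUpperBandwidth (K : Type*) [Field K] : Subalgebra K (TProd K) where
  carrier := {x | ∃ N : ℕ, ∀ (n : ℕ) (a b : Fin (n + 1)), (a : ℕ) + N < b → x n a b = 0}
  mul_mem' := by
    rintro x y ⟨N, hN⟩ ⟨M, hM⟩
    refine ⟨N + M, fun n a b hab => ?_⟩
    rw [Pi.mul_apply, Matrix.mul_apply]
    refine Finset.sum_eq_zero fun c _ => ?_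
    by_cases hc : (a : ℕ) + N < c
    · rw [hN n a c hc, zero_mul]
    · rw [hM n c b (by omega), mul_zero]
  add_mem' := by
    rintro x y ⟨N, hN⟩ ⟨M, hM⟩
    refine ⟨N + M, fun n a b hab => ?_⟩
    rw [Pi.add_apply, Matrix.add_apply, hN n a b (by omega), hM n a b (by omega), add_zero]
  algebraMap_mem' := by
    intro r
    refine ⟨0, fun n a b hab => ?_⟩
    rw [Pi.algebraMap_apply, Matrix.algebraMap_matrix_apply, if_neg]
    rintro rfl
    omega

lemma blockTriangular_ringInverse {x : TProd K}
    (hx : ∀ n, (x n).BlockTriangular OrderDual.toDual) (n : ℕ) :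
    (Ring.inverse x n).BlockTriangular OrderDual.toDual := by
  by_cases hu : IsUnit x
  · have h : Ring.inverse x n = (x n)⁻¹ := by
      refine (Matrix.inv_eq_right_inv ?_).symm
      rw [← Pi.mul_apply, Ring.mul_inverse_cancel x hu, Pi.one_apply]
    have hn : IsUnit (x n) := hu.map (Pi.evalRingHom _ n)
    have := hn.invertible
    rw [h]
    exact Matrix.blockTriangular_inv_of_blockTriangular (hx n)
  · rw [Ring.inverse_non_unit x hu]
    exact Matrix.blockTriangular_zero

lemma blockTriangular_aeval_wT (p : Polynomial K) (n : ℕ) :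
    (Polynomial.aeval (wT K) p n).BlockTriangular OrderDual.toDual := by
  intro a b hab
  rw [OrderDual.toDual_lt_toDual] at hab
  rw [Polynomial.aeval_eq_sum_range, Finset.sum_apply, Matrix.sum_apply]
  refine Finset.sum_eq_zero fun k _ => ?_
  rw [Pi.smul_apply, Matrix.smul_apply, wT_pow_apply, if_neg, smul_zero]
  have : (a : ℕ) < b := hab
  omega

lemma Balg_le_boundedUpperBandwidth : Balg K ≤ boundedUpperBandwidth K := by
  refine Algebra.adjoin_le ?_
  rintro x ((rfl | rfl) | ⟨p, -, rfl⟩)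
  · refine ⟨0, fun n a b hab => ?_⟩
    have := wT_pow_apply (K := K) 1 n a b
    rw [pow_one] at this
    rw [this, if_neg (by omega)]
  · refine ⟨1, fun n a b hab => ?_⟩
    have := wstarT_pow_apply (K := K) 1 n a b
    rw [pow_one] at this
    rw [this, if_neg (by omega)]
  · refine ⟨0, fun n a b hab => ?_⟩
    refine blockTriangular_ringInverse (blockTriangular_aeval_wT p) n ?_
    rw [OrderDual.toDual_lt_toDual]
    exact Fin.lt_def.mpr (by omega)

lemma mul_single_mul_apply {m : Type*} [Fintype m] [DecidableEq m] (A B : Matrix m m K)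
    (a b p q : m) (c : K) : (A * Matrix.single a b c * B) p q = A p a * c * B b q := by
  rw [Matrix.mul_apply, Finset.sum_eq_single b]
  · rw [Matrix.mul_single_apply_same]
  · intro d _ hd
    rw [Matrix.mul_single_apply_of_ne _ _ _ _ _ hd, zero_mul]
  · simp

lemma corner_mem_socSet {b : TProd K} (hb : b ∈ Balg K) :
    (1 - wT K * wstarT K) * b * (1 - wstarT K * wT K) ∈ socSet K := by
  obtain ⟨N, hN⟩ := Balg_le_boundedUpperBandwidth hb
  refine ⟨N + 1, fun n hn => ?_⟩
  rw [Pi.mul_apply, Pi.mul_apply, one_sub_wT_mul_wstarT, one_sub_wstarT_mul_wT,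
    Matrix.single_mul_mul_single, hN n _ _ (by simp; omega)]
  simp

lemma pow_mul_corner_mul_pow (k : ℕ) (i j : Fin (k + 1)) :
    wT K ^ (i : ℕ) * (1 - wT K * wstarT K) * wstarT K ^ k *
      ((1 - wstarT K * wT K) * wT K ^ (k - j)) = Pi.single k (Matrix.single i j 1) := by
  funext m
  have h : (1 - wT K * wstarT K) m * (wstarT K ^ k) m * (1 - wstarT K * wT K) m =
      Matrix.single 0 (Fin.last m) (if m = k then 1 else 0) := by
    rw [one_sub_wT_mul_wstarT, one_sub_wstarT_mul_wT, Matrix.single_mul_mul_single,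
      wstarT_pow_apply]
    simp
  have h' : (wT K ^ (i : ℕ) * (1 - wT K * wstarT K) * wstarT K ^ k *
      ((1 - wstarT K * wT K) * wT K ^ (k - j))) m =
      (wT K ^ (i : ℕ)) m * Matrix.single 0 (Fin.last m) (if m = k then 1 else 0) *
        (wT K ^ (k - j)) m := by
    rw [← h]
    simp only [Pi.mul_apply, mul_assoc]
  rw [h']
  obtain rfl | hm := eq_or_ne m k
  · ext p q
    rw [mul_single_mul_apply, wT_pow_apply, wT_pow_apply, Pi.single_eq_same, Matrix.single_apply]
    simp only [Fin.ext_iff, Fin.val_zero, Fin.val_last, zero_add, if_true, mul_one]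
    have := j.isLt
    split_ifs <;> first | omega | simp
  · simp [hm]

lemma pow_mul_corner_mul_pow' (k : ℕ) (i j : Fin (k + 1)) :
    wstarT K ^ (k - i) * (1 - wstarT K * wT K) * wT K ^ k *
      ((1 - wT K * wstarT K) * wstarT K ^ (j : ℕ)) = Pi.single k (Matrix.single i j 1) := by
  funext m
  have h : (1 - wstarT K * wT K) m * (wT K ^ k) m * (1 - wT K * wstarT K) m =
      Matrix.single (Fin.last m) 0 (if m = k then 1 else 0) := by
    rw [one_sub_wT_mul_wstarT, one_sub_wstarT_mul_wT, Matrix.single_mul_mul_single,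
      wT_pow_apply]
    simp
  have h' : (wstarT K ^ (k - i) * (1 - wstarT K * wT K) * wT K ^ k *
      ((1 - wT K * wstarT K) * wstarT K ^ (j : ℕ))) m =
      (wstarT K ^ (k - i)) m * Matrix.single (Fin.last m) 0 (if m = k then 1 else 0) *
        (wstarT K ^ (j : ℕ)) m := by
    rw [← h]
    simp only [Pi.mul_apply, mul_assoc]
  rw [h']
  obtain rfl | hm := eq_or_ne m k
  · ext p q
    rw [mul_single_mul_apply, wstarT_pow_apply, wstarT_pow_apply, Pi.single_eq_same,
      Matrix.single_apply]
    simp only [Fin.ext_iff, Fin.val_zero, Fin.val_last, zero_add, if_true, mul_one]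
    have := i.isLt
    split_ifs <;> first | omega | simp
  · simp [hm]

lemma socSet_subset_of_single_mem {S : AddSubmonoid (TProd K)}
    (hS : ∀ (k : ℕ) (i j : Fin (k + 1)) (c : K), Pi.single k (Matrix.single i j c) ∈ S) :
    socSet K ⊆ S := by
  rintro z ⟨N, hN⟩
  have hz : z = ∑ k ∈ Finset.range N, Pi.single k (z k) := by
    funext n
    rw [Finset.sum_apply, Finset.sum_pi_single]
    split_ifs with h
    · rfl
    · exact hN n (by simpa using h)
  rw [hz]
  refine sum_mem fun k _ => ?_
  rw [Matrix.matrix_eq_sum_single (z k)]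
  have hsum : ∀ {ι : Type} (s : Finset ι) (f : ι → Matrix (Fin (k + 1)) (Fin (k + 1)) K),
      (Pi.single k (∑ i ∈ s, f i) : TProd K) = ∑ i ∈ s, Pi.single k (f i) := fun s f =>
    map_sum (AddMonoidHom.single (fun n => Matrix (Fin (n + 1)) (Fin (n + 1)) K) k) f s
  rw [hsum]
  refine sum_mem fun i _ => ?_
  rw [hsum]
  exact sum_mem fun j _ => hS k i j _

lemma mem_closure_mul_of_mem_socSet (P Q : TwoSidedIdeal (Balg K))
    (hPQ : ∀ (k : ℕ) (i j : Fin (k + 1)), ∃ x ∈ P, ∃ y ∈ Q,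
      ((x * y : Balg K) : TProd K) = Pi.single k (Matrix.single i j 1))
    {z : Balg K} (hz : (z : TProd K) ∈ socSet K) :
    z ∈ AddSubmonoid.closure {z : Balg K | ∃ x ∈ P, ∃ y ∈ Q, z = x * y} := by
  set C := AddSubmonoid.closure {z : Balg K | ∃ x ∈ P, ∃ y ∈ Q, z = x * y}
  have h : (z : TProd K) ∈ C.map (Balg K).val.toRingHom.toAddMonoidHom := by
    refine socSet_subset_of_single_mem (fun k i j c => ?_) hz
    obtain ⟨x, hx, y, hy, hxy⟩ := hPQ k i j
    refine ⟨(algebraMap K (Balg K) c * x) * y, AddSubmonoid.subset_closure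
      ⟨_, P.mul_mem_left _ _ hx, y, hy, rfl⟩, ?_⟩
    change ((algebraMap K (Balg K) c * x * y : Balg K) : TProd K) = _
    rw [mul_assoc, ← Algebra.smul_def, Subalgebra.coe_smul, hxy, ← Pi.single_smul,
      Matrix.smul_single, smul_eq_mul, mul_one]
  obtain ⟨z', hz', h⟩ := h
  rwa [← Subtype.ext (show (z' : TProd K) = z from h)]

lemma add_mem_socSet {x y : TProd K} (hx : x ∈ socSet K) (hy : y ∈ socSet K) :
    x + y ∈ socSet K := by
  obtain ⟨N, hN⟩ := hx
  obtain ⟨M, hM⟩ := hy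
  exact ⟨N + M, fun n hn => by
    rw [Pi.add_apply, hN n (by omega), hM n (by omega), add_zero]⟩

lemma mul_mem_socSet_left (a : TProd K) {x : TProd K} (hx : x ∈ socSet K) :
    a * x ∈ socSet K :=
  hx.imp fun _ hN n hn => by rw [Pi.mul_apply, hN n hn, mul_zero]

lemma mul_mem_socSet_right {x : TProd K} (a : TProd K) (hx : x ∈ socSet K) :
    x * a ∈ socSet K :=
  hx.imp fun _ hN n hn => by rw [Pi.mul_apply, hN n hn, zero_mul]

lemma zero_mem_socSet : (0 : TProd K) ∈ socSet K := ⟨0, fun _ _ => rfl⟩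

/-- If `e * b * f` has finite support for all `e ∈ S`, `f ∈ S'` and `b`, then so does every
product from the ideals generated by `S` and `S'`. -/
lemma mul_mem_socSet_of_mem_span {S S' : Set (Balg K)}
    (h : ∀ e ∈ S, ∀ f ∈ S', ∀ b : Balg K, ((e * b * f : Balg K) : TProd K) ∈ socSet K)
    {x y : Balg K} (hx : x ∈ TwoSidedIdeal.span S) (hy : y ∈ TwoSidedIdeal.span S') :
    ((x * y : Balg K) : TProd K) ∈ socSet K := by
  have hneg : ∀ {x : TProd K}, x ∈ socSet K → -x ∈ socSet K := fun hx => by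
    rw [neg_eq_neg_one_mul]; exact mul_mem_socSet_left _ hx
  have hS' : ∀ e ∈ S, ∀ b : Balg K, ((e * b * y : Balg K) : TProd K) ∈ socSet K := by
    intro e he
    induction hy using TwoSidedIdeal.span_induction with
    | mem f hf => exact h e he f hf
    | zero => intro b; simpa using zero_mem_socSet
    | add u v _ _ hu hv => intro b; rw [mul_add]; exact add_mem_socSet (hu b) (hv b)
    | neg u _ hu =>
      intro b
      change (e * b : TProd K) * -(u : TProd K) ∈ socSet K
      rw [mul_neg]
      exact hneg (hu b)
    | left_absorb a u _ hu => intro b; rw [← mul_assoc, mul_assoc e]; exact hu _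
    | right_absorb a u _ hu => intro b; rw [← mul_assoc]; exact mul_mem_socSet_right _ (hu b)
  suffices hmain : ∀ b : Balg K, ((x * b * y : Balg K) : TProd K) ∈ socSet K by
    simpa using hmain 1
  induction hx using TwoSidedIdeal.span_induction with
  | mem e he => exact hS' e he
  | zero => intro b; simpa using zero_mem_socSet
  | add u v _ _ hu hv => intro b; rw [add_mul, add_mul]; exact add_mem_socSet (hu b) (hv b)
  | neg u _ hu =>
    intro b
    change -(u : TProd K) * b * y ∈ socSet K
    rw [neg_mul, neg_mul]
    exact hneg (hu b)
  | left_absorb a u _ hu =>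
    intro b; rw [mul_assoc a, mul_assoc a]; exact mul_mem_socSet_left _ (hu b)
  | right_absorb a u _ hu => intro b; rw [mul_assoc u]; exact hu _

end ShiftProduct

open ShiftProduct in
/-- Lemma 4.7 of the paper (product of ideals part): with `I` and `J` the two-sided
ideals of `B ≅ Σ⁻¹K[𝓕]` generated by `1 − w w*` and `1 − w* w` respectively, one has
`I·J = ⊕ M_i(K)` and `⊕ M_i(K) ⊆ J·I`. -/
theorem stmt12 {K : Type*} [Field K]
    (I J : TwoSidedIdeal (Balg K))
    (hI : I = TwoSidedIdeal.span {x : Balg K | (x : TProd K) = 1 - wT K * wstarT K})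
    (hJ : J = TwoSidedIdeal.span {x : Balg K | (x : TProd K) = 1 - wstarT K * wT K}) :
    (AddSubmonoid.closure {z : Balg K | ∃ x ∈ I, ∃ y ∈ J, z = x * y} : Set (Balg K)) =
      {z : Balg K | (z : TProd K) ∈ socSet K} ∧
    {z : Balg K | (z : TProd K) ∈ socSet K} ⊆
      (AddSubmonoid.closure {z : Balg K | ∃ x ∈ J, ∃ y ∈ I, z = x * y} : Set (Balg K)) := by
  let W : Balg K := ⟨wT K, Algebra.subset_adjoin (by simp)⟩
  let V : Balg K := ⟨wstarT K, Algebra.subset_adjoin (by simp)⟩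
  have hE : 1 - W * V ∈ I := hI ▸ TwoSidedIdeal.subset_span rfl
  have hF : 1 - V * W ∈ J := hJ ▸ TwoSidedIdeal.subset_span rfl
  refine ⟨Set.Subset.antisymm ?_ fun z hz => ?_, fun z hz => ?_⟩
  · intro z hz
    induction hz using AddSubmonoid.closure_induction with
    | mem z hz =>
      obtain ⟨x, hx, y, hy, rfl⟩ := hz
      subst hI hJ
      refine mul_mem_socSet_of_mem_span (fun e he f hf b => ?_) hx hy
      have := corner_mem_socSet b.2
      rwa [← show (e : TProd K) = _ from he, ← show (f : TProd K) = _ from hf] at this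
    | zero => exact zero_mem_socSet
    | add x y _ _ hx hy => exact add_mem_socSet hx hy
  · exact mem_closure_mul_of_mem_socSet I J (fun k i j =>
      ⟨W ^ (i : ℕ) * (1 - W * V) * V ^ k, I.mul_mem_right _ _ (I.mul_mem_left _ _ hE),
        (1 - V * W) * W ^ (k - j), J.mul_mem_right _ _ hF, pow_mul_corner_mul_pow k i j⟩) hz
  · exact mem_closure_mul_of_mem_socSet J I (fun k i j =>
      ⟨V ^ (k - i) * (1 - V * W) * W ^ k, J.mul_mem_right _ _ (J.mul_mem_left _ _ hF),
        (1 - W * V) * V ^ (j : ℕ), I.mul_mem_right _ _ hE, pow_mul_corner_mul_pow' k i j⟩) hz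
end

section
/- For every rational sequence a ∈ 𝓡° there exists an idempotent e ∈ 𝓡° such that, for every n ∈ ℕ, e(n) = 1 if a(n) = 0 and e(n) = 0 if a(n) ≠ 0. Consequently, the annihilator of a in the pointwise ring ℕ → k is the principal ideal generated by the idempotent e, which lies in 𝓡°. -/
namespace RationalSeq

open Polynomial

/-- a sequence `a : ℕ → k` is rational if its generating function is the power series
expansion of a rational function `P/Q` with `Q(0) = 1`. -/
def IsRational {k : Type*} [Field k] (a : ℕ → k) : Prop :=
  ∃ P Q : k[X], Q.coeff 0 = 1 ∧
    (PowerSeries.mk a) * (Q : PowerSeries k) = (P : PowerSeries k)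

open Matrix

/-- If `c` divides the coefficients of `f` of degree at least `k` and `f` has `k` distinct roots,
then `c` divides all the values of `f`. -/
theorem dvd_eval_of_dvd_coeff_of_roots {A : Type*} [CommRing A] [IsDomain A] (c : A) (s : Finset A)
    (f : A[X]) (hf : ∀ j, s.card ≤ j → c ∣ f.coeff j) (hs : ∀ t ∈ s, f.IsRoot t) (x : A) :
    c ∣ f.eval x := by
  classical
  induction s using Finset.induction_on generalizing f with
  | empty =>
    rw [eval_eq_sum_range]
    exact Finset.dvd_sum fun j _ => (hf j (by simp)).mul_right _
  | insert t s ht ih =>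
    have hmul : (X - C t) * (f /ₘ (X - C t)) = f :=
      mul_divByMonic_eq_iff_isRoot.mpr (hs t (Finset.mem_insert_self t s))
    have hq : c ∣ (f /ₘ (X - C t)).eval x := by
      refine ih _ (fun j hj => ?_) fun u hu => ?_
      · rw [coeff_divByMonic_X_sub_C]
        refine Finset.dvd_sum fun i hi => (hf i ?_).mul_left _
        rw [Finset.card_insert_of_notMem ht]
        exact (Nat.succ_le_succ hj).trans (Finset.mem_Icc.mp hi).1
      · have h := hs u (Finset.mem_insert_of_mem hu)
        rw [← hmul, IsRoot.def, eval_mul, mul_eq_zero] at h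
        refine h.resolve_left ?_
        simpa [sub_eq_zero] using fun h : u = t => ht (h ▸ hu)
    rw [← hmul, eval_mul]
    exact hq.mul_left _

theorem factorial_dvd_pow (p : ℕ) [Fact p.Prime] (j : ℕ) :
    (j.factorial : ℤ_[p]) ∣ (p : ℤ_[p]) ^ j := by
  have hp : p.Prime := Fact.out
  have h0 : (j.factorial : ℤ_[p]) ≠ 0 := by exact_mod_cast j.factorial_ne_zero
  have hle : (j.factorial : ℤ_[p]).valuation ≤ j := by
    zify
    rw [← PadicInt.valuation_coe, PadicInt.coe_natCast, Padic.valuation_natCast]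
    norm_cast
    calc padicValNat p j.factorial ≤ (p - 1) * padicValNat p j.factorial :=
          Nat.le_mul_of_pos_left _ (Nat.sub_pos_of_lt hp.one_lt)
      _ ≤ j := by rw [sub_one_mul_padicValNat_factorial]; exact Nat.sub_le _ _
  rw [PadicInt.unitCoeff_spec h0, Units.mul_left_dvd]
  exact pow_dvd_pow _ hle

/-- Skolem's argument: a Newton series with coefficients divisible by `p ^ (2 * j)` that has
infinitely many zeros vanishes identically. -/
theorem newtonSeries_eq_zero (p : ℕ) [Fact p.Prime] (d f : ℕ → ℤ)
    (hf : ∀ n, f n = ∑ j ∈ Finset.range (n + 1), (n.choose j : ℤ) * ((p : ℤ) ^ (2 * j) * d j))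
    (hinf : {n | f n = 0}.Infinite) (n : ℕ) : f n = 0 := by
  choose e he using factorial_dvd_pow p
  have key : ∀ k : ℕ, (p : ℤ) ^ k ∣ f n := by
    intro k
    obtain ⟨s, hs, hk⟩ := hinf.exists_subset_card_eq k
    obtain ⟨N, hN⟩ : ∃ N, ∀ m ∈ insert n s, m ≤ N := ⟨_, fun m hm => Finset.le_sup (f := id) hm⟩
    let g : ℤ_[p][X] := ∑ j ∈ Finset.range (N + 1),
      C ((p : ℤ_[p]) ^ j * (e j * d j)) * descPochhammer ℤ_[p] j
    have hg : ∀ m ≤ N, g.eval (m : ℤ_[p]) = f m := by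
      intro m hm
      have hsub : Finset.range (m + 1) ⊆ Finset.range (N + 1) :=
        Finset.range_mono (by omega)
      rw [hf, Int.cast_sum, Finset.sum_subset hsub, eval_finsetSum]
      · refine Finset.sum_congr rfl fun j _ => ?_
        rw [eval_mul, eval_C, descPochhammer_eval_eq_descFactorial,
          Nat.descFactorial_eq_factorial_mul_choose]
        push_cast
        linear_combination (-(m.choose j : ℤ_[p]) * (p : ℤ_[p]) ^ j * d j) * he j
      · intro j _ hj
        rw [Nat.choose_eq_zero_of_lt (by simpa using hj)]
        simp
    rw [← PadicInt.pow_p_dvd_int_iff, ← hg n (hN n (by simp))]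
    refine dvd_eval_of_dvd_coeff_of_roots _ (s.map ⟨Nat.cast, Nat.cast_injective⟩) g ?_ ?_ _
    · intro i hi
      rw [Finset.card_map, hk] at hi
      rw [finsetSum_coeff]
      refine Finset.dvd_sum fun j _ => ?_
      rw [coeff_C_mul]
      rcases lt_or_ge j i with hji | hji
      · rw [coeff_eq_zero_of_natDegree_lt (by simpa using hji)]
        simp
      · exact ((pow_dvd_pow _ (hi.trans hji)).mul_right _).mul_right _
    · intro t ht
      obtain ⟨m, hm, rfl⟩ := Finset.mem_map.mp ht
      have h0 : f m = 0 := hs hm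
      simp [IsRoot.def, hg m (hN m (Finset.mem_insert_of_mem hm)), h0]
  by_contra h
  obtain ⟨k, hk⟩ := (Int.finiteMultiplicity_iff (a := (p : ℤ)) (b := f n)).mpr
    ⟨by simpa using (Fact.out : p.Prime).ne_one, h⟩
  exact hk (key _)

theorem dotProduct_pow_mulVec_eq_zero {m : Type*} [Fintype m] [DecidableEq m] (p : ℕ)
    [Fact p.Prime] (B : Matrix m m ℤ)
    (hB : (Int.castRingHom (ZMod (p ^ 2))).mapMatrix B = 1) (u v : m → ℤ)
    (hinf : {n | u ⬝ᵥ (B ^ n) *ᵥ v = 0}.Infinite) (n : ℕ) : u ⬝ᵥ (B ^ n) *ᵥ v = 0 := by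
  obtain ⟨C, hC⟩ : ∃ C : Matrix m m ℤ, B = ((p : ℤ) ^ 2) • C + 1 := by
    have h : ∀ i j, ((p ^ 2 : ℕ) : ℤ) ∣ B i j - (1 : Matrix m m ℤ) i j := by
      intro i j
      rw [← ZMod.intCast_zmod_eq_zero_iff_dvd]
      have h := congrFun (congrFun hB i) j
      rw [RingHom.mapMatrix_apply, map_apply, eq_intCast] at h
      rw [Int.cast_sub, h, one_apply, one_apply]
      split_ifs <;> simp
    choose C hC using h
    refine ⟨of C, ?_⟩
    ext i j
    have h := hC i j
    push_cast at h
    rw [Matrix.add_apply, Matrix.smul_apply, of_apply, smul_eq_mul, ← h, sub_add_cancel]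
  refine newtonSeries_eq_zero p (fun j => u ⬝ᵥ (C ^ j) *ᵥ v) (fun n => u ⬝ᵥ (B ^ n) *ᵥ v) ?_ hinf n
  intro n
  have hpow : B ^ n = ∑ j ∈ Finset.range (n + 1),
      ((n.choose j : ℤ) * (p : ℤ) ^ (2 * j)) • C ^ j := by
    rw [hC, (Commute.one_right (((p : ℤ) ^ 2) • C)).add_pow]
    refine Finset.sum_congr rfl fun j _ => ?_
    rw [one_pow, mul_one, _root_.smul_pow, ← pow_mul, ← nsmul_eq_mul', ← natCast_zsmul, smul_smul]
  simp only [hpow, sum_mulVec, dotProduct_sum, smul_mulVec, dotProduct_smul, smul_eq_mul, mul_assoc]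

theorem map_dotProduct_mulVec_pow {R S m : Type*} [CommSemiring R] [CommSemiring S] [Fintype m]
    [DecidableEq m] (f : R →+* S) (A : Matrix m m R) (u v : m → R) (M n : ℕ) :
    f (u ⬝ᵥ ((A ^ M) ^ n) *ᵥ v) = (f ∘ u) ⬝ᵥ ((f.mapMatrix A ^ M) ^ n) *ᵥ (f ∘ v) := by
  rw [RingHom.map_dotProduct, ← map_pow, ← map_pow, RingHom.mapMatrix_apply]
  congr 1
  ext i
  simp [RingHom.map_mulVec]

/-- For a nonsingular matrix `A` of integer polynomials there is a single `M` such that every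
matrix coefficient of the powers of `A ^ M` with infinitely many zeros vanishes identically.
`M` is found by specializing the variables to integers with a fixed residue modulo `p ^ 2`. -/
theorem exists_period_mvPolynomial {ι m : Type*} [Fintype m] [DecidableEq m]
    (A : Matrix m m (MvPolynomial ι ℤ)) (hA : A.det ≠ 0) :
    ∃ M > 0, ∀ u v : m → MvPolynomial ι ℤ, {n | u ⬝ᵥ ((A ^ M) ^ n) *ᵥ v = 0}.Infinite →
      ∀ n, u ⬝ᵥ ((A ^ M) ^ n) *ᵥ v = 0 := by
  obtain ⟨τ, hτ⟩ : ∃ τ : ι → ℤ, MvPolynomial.eval τ A.det ≠ 0 := by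
    by_contra! h
    exact hA (MvPolynomial.funext (by simpa using h))
  obtain ⟨p, hpgt, hp⟩ := Nat.exists_infinite_primes ((MvPolynomial.eval τ A.det).natAbs + 1)
  have : Fact p.Prime := ⟨hp⟩
  have : NeZero (p ^ 2) := ⟨(pow_pos hp.pos 2).ne'⟩
  refine ⟨Nat.card (GL m (ZMod (p ^ 2))), Nat.card_pos, fun u v hinf n => ?_⟩
  set M := Nat.card (GL m (ZMod (p ^ 2)))
  have hunit : IsUnit ((MvPolynomial.eval τ A.det : ℤ) : ZMod (p ^ 2)) := by
    rw [ZMod.coe_int_isUnit_iff_isCoprime]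
    push_cast
    refine IsCoprime.pow_left ?_
    rw [Int.isCoprime_iff_nat_coprime, Int.natAbs_natCast]
    refine hp.coprime_iff_not_dvd.mpr fun h => ?_
    have := Nat.le_of_dvd (Int.natAbs_pos.mpr hτ) h
    omega
  have hpoint : ∀ x : ι → ℤ, (∀ i, ((x i : ℤ) : ZMod (p ^ 2)) = τ i) →
      MvPolynomial.eval x (u ⬝ᵥ ((A ^ M) ^ n) *ᵥ v) = 0 := by
    intro x hx
    rw [map_dotProduct_mulVec_pow]
    refine dotProduct_pow_mulVec_eq_zero p _ ?_ _ _ ?_ n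
    · have hred : (Int.castRingHom (ZMod (p ^ 2))).comp (MvPolynomial.eval x) =
          (Int.castRingHom (ZMod (p ^ 2))).comp (MvPolynomial.eval τ) := by
        ext i
        · simp
        · simpa using hx i
      have hdet : IsUnit ((Int.castRingHom (ZMod (p ^ 2))).mapMatrix
          ((MvPolynomial.eval x).mapMatrix A)) := by
        rw [Matrix.isUnit_iff_isUnit_det, ← RingHom.map_det, ← RingHom.map_det]
        rw [← RingHom.comp_apply, hred]
        simpa using hunit
      obtain ⟨G, hG⟩ := hdet
      change (Int.castRingHom (ZMod (p ^ 2))).mapMatrix _ = 1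
      rw [map_pow, ← hG, ← Units.val_pow_eq_pow_val, pow_card_eq_one', Units.val_one]
    · refine hinf.mono fun n hn => ?_
      rw [Set.mem_ofPred_eq, ← map_dotProduct_mulVec_pow, hn, map_zero]
  refine MvPolynomial.funext_set (fun i => {y : ℤ | (y : ZMod (p ^ 2)) = τ i}) (fun i => ?_)
    fun x hx => ?_
  · refine Set.infinite_of_injective_forall_mem (f := fun y : ℤ => τ i + y * (p ^ 2 : ℕ))
      (fun y z h => ?_) fun y => ?_
    · simpa [hp.ne_zero] using h
    · rw [Set.mem_ofPred_eq, Int.cast_add, Int.cast_mul, Int.cast_natCast, ZMod.natCast_self,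
        mul_zero, add_zero]
  · rw [hpoint x fun i => hx i (Set.mem_univ i), map_zero]
/-- The orbit of an injective endomorphism of a finite-dimensional space over the fraction field
of `ℤ[ι]`, sampled along a suitable `M`, meets a kernel finitely often or always. -/
theorem exists_period_of_linearMap {ι K V U : Type*} [Field K] [Algebra (MvPolynomial ι ℤ) K]
    [IsFractionRing (MvPolynomial ι ℤ) K] [AddCommGroup V] [Module K V] [FiniteDimensional K V]
    [AddCommGroup U] [Module K U] (T : V →ₗ[K] V) (hT : Function.Injective T) :
    ∃ M > 0, ∀ (φ : V →ₗ[K] U) (v : V), {n | φ (((T ^ M) ^ n) v) = 0}.Infinite →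
      ∀ n, φ (((T ^ M) ^ n) v) = 0 := by
  let b := Module.finBasis K V
  let A := LinearMap.toMatrixAlgEquiv b T
  have hinj := IsFractionRing.injective (MvPolynomial ι ℤ) K
  have hAdet : A.det ≠ 0 := by
    rw [← isUnit_iff_ne_zero, ← Matrix.isUnit_iff_isUnit_det]
    exact ((LinearMap.isUnit_iff_ker_eq_bot T).mpr (LinearMap.ker_eq_bot.mpr hT)).map _
  obtain ⟨g, hg⟩ := IsLocalization.exist_integer_multiples_of_finite
    (nonZeroDivisors (MvPolynomial ι ℤ)) fun ij : _ × _ => A ij.1 ij.2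
  choose A' hA' using hg
  obtain ⟨γ, hγ', hγ⟩ : ∃ γ : K, γ = algebraMap _ K (g : MvPolynomial ι ℤ) ∧ γ ≠ 0 :=
    ⟨_, rfl, IsFractionRing.to_map_ne_zero_of_mem_nonZeroDivisors g.2⟩
  obtain ⟨B, hB⟩ : ∃ B : Matrix (Fin (Module.finrank K V)) (Fin (Module.finrank K V))
      (MvPolynomial ι ℤ), (algebraMap _ K).mapMatrix B = γ • A := by
    refine ⟨of fun i j => A' (i, j), ?_⟩
    ext i j
    simpa [Algebra.smul_def, hγ'] using hA' (i, j)
  have hBdet : B.det ≠ 0 := by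
    intro h
    have h' := congrArg (algebraMap _ K) h
    rw [RingHom.map_det, hB, det_smul, map_zero] at h'
    exact mul_ne_zero (pow_ne_zero _ hγ) hAdet h'
  obtain ⟨M, hM, hper⟩ := exists_period_mvPolynomial B hBdet
  refine ⟨M, hM, fun φ v hinf n => ?_⟩
  rw [← Module.forall_dual_apply_eq_zero_iff K]
  intro f
  obtain ⟨gu, hgu⟩ := IsLocalization.exist_integer_multiples_of_finite
    (nonZeroDivisors (MvPolynomial ι ℤ)) fun i => f (φ (b i))
  choose u hu using hgu
  obtain ⟨gv, hgv⟩ := IsLocalization.exist_integer_multiples_of_finite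
    (nonZeroDivisors (MvPolynomial ι ℤ)) (b.repr v)
  choose w hw using hgv
  have hgu0 : algebraMap _ K (gu : MvPolynomial ι ℤ) ≠ 0 :=
    IsFractionRing.to_map_ne_zero_of_mem_nonZeroDivisors gu.2
  have hgv0 : algebraMap _ K (gv : MvPolynomial ι ℤ) ≠ 0 :=
    IsFractionRing.to_map_ne_zero_of_mem_nonZeroDivisors gv.2
  have hu' : algebraMap _ K ∘ u = algebraMap _ K (gu : MvPolynomial ι ℤ) • fun i => f (φ (b i)) := by
    ext i
    simpa [Algebra.smul_def] using hu i
  have hw' : algebraMap _ K ∘ w = algebraMap _ K (gv : MvPolynomial ι ℤ) • ⇑(b.repr v) := by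
    ext i
    simpa [Algebra.smul_def] using hw i
  have hcoord : ∀ S : V →ₗ[K] V,
      (fun i => f (φ (b i))) ⬝ᵥ LinearMap.toMatrixAlgEquiv b S *ᵥ ⇑(b.repr v) = f (φ (S v)) := by
    intro S
    change _ ⬝ᵥ LinearMap.toMatrix b b S *ᵥ _ = _
    rw [LinearMap.toMatrix_mulVec_repr]
    conv_rhs => rw [← b.sum_repr (S v)]
    simp only [dotProduct, map_sum, map_smul, smul_eq_mul, mul_comm]
  have heq : ∀ n, algebraMap _ K (u ⬝ᵥ ((B ^ M) ^ n) *ᵥ w) =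
      algebraMap _ K (gu : MvPolynomial ι ℤ) * algebraMap _ K (gv : MvPolynomial ι ℤ) *
        (γ ^ M) ^ n * f (φ (((T ^ M) ^ n) v)) := by
    intro n
    rw [map_dotProduct_mulVec_pow, hu', hw', hB, _root_.smul_pow, _root_.smul_pow, ← map_pow (LinearMap.toMatrixAlgEquiv b),
      ← map_pow (LinearMap.toMatrixAlgEquiv b), smul_dotProduct, smul_mulVec, mulVec_smul, dotProduct_smul, dotProduct_smul,
      hcoord, smul_eq_mul, smul_eq_mul, smul_eq_mul]
    ring
  have hzero : ∀ n, u ⬝ᵥ ((B ^ M) ^ n) *ᵥ w = 0 ↔ f (φ (((T ^ M) ^ n) v)) = 0 := by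
    intro n
    rw [← (map_eq_zero_iff _ hinj), heq]
    simp [hgu0, hgv0, hγ]
  rw [← hzero]
  refine hper u w (hinf.mono fun m hm => (hzero m).mpr ?_) n
  rw [hm, map_zero]

/-- A linear recurrent sequence with nonzero trailing coefficient, over an algebraic extension of
the fraction field of `ℤ[ι]`, has in each class modulo a suitable `M` finitely many zeros or only
zeros. -/
theorem exists_period_of_recurrence {ι K k : Type*} [Field K] [Algebra (MvPolynomial ι ℤ) K]
    [IsFractionRing (MvPolynomial ι ℤ) K] [Field k] [Algebra K k] [Algebra.IsAlgebraic K k]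
    (d : ℕ) (c a : ℕ → k) (hc : c 0 ≠ 0)
    (ha : ∀ n, a (n + d) = ∑ i ∈ Finset.range d, c i * a (n + i)) :
    ∃ M > 0, ∀ r, {n | a (r + M * n) = 0}.Infinite → ∀ n, a (r + M * n) = 0 := by
  let S : Set k := c '' Finset.range d ∪ a '' Finset.range d
  have : Finite S := ((Finset.finite_toSet _).image _).union ((Finset.finite_toSet _).image _)
  let L := IntermediateField.adjoin K S
  have : FiniteDimensional K L := IntermediateField.finiteDimensional_adjoin fun x _ =>
    (Algebra.IsAlgebraic.isAlgebraic x).isIntegral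
  let V : Submodule K (ℕ → k) :=
    { carrier := {b | (∀ n, b (n + d) = ∑ i ∈ Finset.range d, c i * b (n + i)) ∧ ∀ n, b n ∈ L}
      add_mem' := fun {x y} hx hy => ⟨fun n => by
        simp only [Pi.add_apply, hx.1, hy.1, mul_add, Finset.sum_add_distrib],
        fun n => add_mem (hx.2 n) (hy.2 n)⟩
      zero_mem' := ⟨fun n => by simp, fun n => zero_mem _⟩
      smul_mem' := fun t x hx => ⟨fun n => by
        simp only [Pi.smul_apply, hx.1, Finset.smul_sum, mul_smul_comm],
        fun n => L.smul_mem (hx.2 n)⟩ }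
  have haV : a ∈ V := by
    refine ⟨ha, fun n => ?_⟩
    induction n using Nat.strong_induction_on with
    | _ n ih =>
      rcases lt_or_ge n d with h | h
      · exact IntermediateField.subset_adjoin K S (Or.inr ⟨n, by simpa using h, rfl⟩)
      · obtain ⟨m, rfl⟩ := Nat.exists_eq_add_of_le' h
        rw [ha]
        refine sum_mem fun i hi => mul_mem ?_ (ih _ ?_)
        · exact IntermediateField.subset_adjoin K S (Or.inl ⟨i, hi, rfl⟩)
        · have := Finset.mem_range.mp hi
          omega
  let init : V →ₗ[K] (Fin d → L) :=
    { toFun := fun b i => ⟨b.1 i, b.2.2 i⟩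
      map_add' := fun _ _ => rfl
      map_smul' := fun _ _ => rfl }
  have hinit : Function.Injective init := by
    rw [injective_iff_map_eq_zero]
    intro b hb
    ext n
    induction n using Nat.strong_induction_on with
    | _ n ih =>
      rcases lt_or_ge n d with h | h
      · exact congrArg Subtype.val (congrFun hb ⟨n, h⟩)
      · obtain ⟨m, rfl⟩ := Nat.exists_eq_add_of_le' h
        rw [b.2.1]
        refine Finset.sum_eq_zero fun i hi => ?_
        rw [ih (m + i) (by have := Finset.mem_range.mp hi; omega)]
        simp
  have : FiniteDimensional K V := FiniteDimensional.of_injective init hinit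
  let T : V →ₗ[K] V :=
    { toFun := fun b => ⟨fun n => b.1 (n + 1), fun n => by
        simpa [add_right_comm] using b.2.1 (n + 1), fun n => b.2.2 _⟩
      map_add' := fun _ _ => rfl
      map_smul' := fun _ _ => rfl }
  have hT : Function.Injective T := by
    rw [injective_iff_map_eq_zero]
    intro b hb
    have hsucc : ∀ n, b.1 (n + 1) = 0 := fun n => congrFun (congrArg Subtype.val hb) n
    ext n
    rcases n with _ | n
    · have h := b.2.1 0
      rcases d with _ | d
      · simpa using h
      · rw [Finset.sum_range_succ'] at h
        simpa [hsucc, hc] using h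
    · exact hsucc n
  have hTpow : ∀ (n : ℕ) (b : V) (m : ℕ), ((T ^ n) b).1 m = b.1 (m + n) := by
    intro n
    induction n with
    | zero => exact fun b m => rfl
    | succ n ih =>
      intro b m
      rw [pow_succ, Module.End.mul_apply, ih]
      exact congrArg b.1 (by omega)
  obtain ⟨M, hM, h⟩ := exists_period_of_linearMap (ι := ι) (U := k) T hT
  refine ⟨M, hM, fun r => ?_⟩
  have hval : ∀ n, a (r + M * n) =
      (LinearMap.proj 0 ∘ₗ V.subtype : V →ₗ[K] k) (((T ^ M) ^ n) ((T ^ r) ⟨a, haV⟩)) := by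
    intro n
    simp only [LinearMap.comp_apply, Submodule.subtype_apply, LinearMap.proj_apply]
    rw [← pow_mul, hTpow, hTpow]
    exact congrArg a (by omega)
  simp only [hval]
  exact h _ _

theorem IsRational.exists_recurrence {k : Type*} [Field k] {a : ℕ → k} (ha : IsRational a) :
    ∃ (N d : ℕ) (c : ℕ → k), c 0 ≠ 0 ∧
      ∀ n, a (N + (n + d)) = ∑ i ∈ Finset.range d, c i * a (N + (n + i)) := by
  obtain ⟨P, Q, hQ, h⟩ := ha
  refine ⟨P.natDegree + 1, Q.natDegree, fun i => -Q.coeff (Q.natDegree - i), ?_, fun n => ?_⟩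
  · have : Q ≠ 0 := by rintro rfl; simp at hQ
    simpa
  · have hn := congrArg (PowerSeries.coeff (P.natDegree + 1 + n + Q.natDegree)) h
    rw [coeff_coe, coeff_eq_zero_of_natDegree_lt (by omega), PowerSeries.coeff_mul,
      Finset.Nat.sum_antidiagonal_eq_sum_range_succ
        (fun i j => PowerSeries.coeff i (PowerSeries.mk a) * PowerSeries.coeff j (Q : PowerSeries k)),
      Nat.succ_eq_add_one, add_assoc (P.natDegree + 1 + n), Finset.sum_range_add,
      Finset.sum_eq_zero, zero_add, Finset.sum_range_succ] at hn
    · simp only [PowerSeries.coeff_mk, coeff_coe, Nat.sub_self, hQ, mul_one,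
        Nat.add_sub_add_left] at hn
      rw [← add_assoc, eq_neg_of_add_eq_zero_right hn, ← Finset.sum_neg_distrib]
      refine Finset.sum_congr rfl fun i _ => ?_
      rw [← add_assoc]
      ring
    · intro i hi
      rw [coeff_coe, coeff_eq_zero_of_natDegree_lt, mul_zero]
      have := Finset.mem_range.mp hi
      omega

theorem isRational_of_eventually_periodic {k : Type*} [Field k] {e : ℕ → k} {N M : ℕ}
    (hM : 0 < M) (he : ∀ n ≥ N, e (n + M) = e n) : IsRational e := by
  refine ⟨PowerSeries.trunc (N + M) (PowerSeries.mk e * (1 - PowerSeries.X ^ M)), 1 - X ^ M, ?_, ?_⟩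
  · simp [coeff_X_pow, hM.ne]
  · ext n
    rw [coeff_coe, PowerSeries.coeff_trunc]
    push_cast
    split_ifs with hn
    · rfl
    · rw [mul_sub, mul_one, map_sub, PowerSeries.coeff_mul_X_pow', if_pos (by omega),
        PowerSeries.coeff_mk, PowerSeries.coeff_mk, ← he (n - M) (by omega),
        Nat.sub_add_cancel (by omega), sub_self]

/-- The **Skolem–Mahler–Lech theorem**: in characteristic zero, the zero set of a rational
sequence is eventually periodic. -/
theorem IsRational.eventually_periodic_zeros {k : Type*} [Field k] [CharZero k] {a : ℕ → k}
    (ha : IsRational a) : ∃ N, ∃ M > 0, ∀ n ≥ N, a (n + M) = 0 ↔ a n = 0 := by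
  obtain ⟨N, d, c, hc, hrec⟩ := ha.exists_recurrence
  obtain ⟨s, hs⟩ := exists_isTranscendenceBasis ℤ k
  let f : MvPolynomial s ℤ →+* k := (MvPolynomial.aeval ((↑) : s → k)).toRingHom
  have hf : Function.Injective f := hs.1
  let _ : Algebra (MvPolynomial s ℤ) k := f.toAlgebra
  have : FaithfulSMul (MvPolynomial s ℤ) k := (faithfulSMul_iff_algebraMap_injective _ _).mpr hf
  have : Algebra.IsAlgebraic (MvPolynomial s ℤ) k := by
    have := hs.isAlgebraic
    exact .of_ringHom_of_comp_eq hs.1.aevalEquiv (RingHom.id k) hs.1.aevalEquiv.surjective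
      Function.injective_id (RingHom.ext fun p => hs.1.algebraMap_aevalEquiv p)
  let K := FractionRing (MvPolynomial s ℤ)
  let _ : Algebra K k := FractionRing.liftAlgebra (MvPolynomial s ℤ) k
  have : IsScalarTower (MvPolynomial s ℤ) K k := inferInstance
  have : Algebra.IsAlgebraic K k := Algebra.IsAlgebraic.extendScalars (IsFractionRing.injective (MvPolynomial s ℤ) K)
  obtain ⟨M, hM, hper⟩ :=
    exists_period_of_recurrence (ι := s) (K := K) d c (fun n => a (N + n)) hc hrec
  have hev : ∀ r, ∃ B, ∀ n ≥ B, a (N + (r + M * (n + 1))) = 0 ↔ a (N + (r + M * n)) = 0 := by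
    intro r
    by_cases hinf : {n | a (N + (r + M * n)) = 0}.Infinite
    · exact ⟨0, fun n _ => by simp only [hper r hinf]⟩
    · obtain ⟨B, hB⟩ := (Set.not_infinite.mp hinf).bddAbove
      have hne : ∀ n > B, a (N + (r + M * n)) ≠ 0 := fun n hn h => hn.not_ge (hB h)
      exact ⟨B + 1, fun n hn => iff_of_false (hne _ (by omega)) (hne _ (by omega))⟩
  choose B hB using hev
  let C := (Finset.range M).sup B
  refine ⟨N + M * (C + 1), M, hM, fun n hn => ?_⟩
  have hq : C ≤ (n - N) / M := by
    rw [Nat.le_div_iff_mul_le hM]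
    rw [mul_add, mul_comm M C] at hn
    omega
  have hr : (n - N) % M < M := Nat.mod_lt _ hM
  have h := hB ((n - N) % M) ((n - N) / M)
    ((Finset.le_sup (f := B) (Finset.mem_range.mpr hr)).trans hq)
  have hn0 := Nat.mod_add_div (n - N) M
  rw [mul_add, mul_one, ← add_assoc _ _ M, hn0, ← add_assoc, Nat.add_sub_cancel' (by
    exact (Nat.le_add_right _ _).trans hn)] at h
  exact h

end RationalSeq

open RationalSeq in
/-- By the Skolem–Mahler–Lech theorem (characteristic zero), the zero set of a rational
sequence is the support of a rational idempotent; hence the annihilator of a rational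
sequence in the pointwise ring `ℕ → k` is the principal ideal generated by a rational
idempotent. -/
theorem stmt15 {k : Type*} [Field k] [CharZero k] (a : ℕ → k) (ha : IsRational a) :
    ∃ e : ℕ → k, IsRational e ∧ (∀ n : ℕ, e n * e n = e n) ∧
      (∀ n : ℕ, (a n = 0 → e n = 1) ∧ (a n ≠ 0 → e n = 0)) ∧
      (∀ b : ℕ → k, (∀ n : ℕ, a n * b n = 0) ↔ ∃ c : ℕ → k, b = fun n => e n * c n) := by
  classical
  obtain ⟨N, M, hM, hper⟩ := ha.eventually_periodic_zeros
  refine ⟨fun n => if a n = 0 then 1 else 0,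
    isRational_of_eventually_periodic (N := N) hM fun n hn => if_congr (hper n hn) rfl rfl,
    fun n => by simp, fun n => ⟨fun h => if_pos h, fun h => if_neg h⟩, fun b => ⟨fun h => ?_, ?_⟩⟩
  · refine ⟨b, funext fun n => ?_⟩
    by_cases hn : a n = 0
    · simp [hn]
    · simpa [hn] using h n
  · rintro ⟨c, rfl⟩ n
    by_cases hn : a n = 0 <;> simp [hn]
end

section
/- Let 𝓠 = {a·b⁻¹ : a, b ∈ 𝓡° and b(n) ≠ 0 for all n} ⊆ (ℕ → k), where b⁻¹ denotes the pointwise inverse. Then 𝓠 is a subring of the pointwise ring ℕ → k, 𝓠 is von Neumann regular (for every q ∈ 𝓠 there is q' ∈ 𝓠 with q·q'·q = q), and 𝓠 is contained in every von Neumann regular subring of ℕ → k that contains 𝓡°; hence 𝓠 is the smallest von Neumann regular subring of ℕ → k containing 𝓡°. -/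
namespace RationalSeq

open Polynomial

/-- the set `𝓠` of quotients `a·b⁻¹` of rational sequences with `b` pointwise nonzero. -/
def Qset (k : Type*) [Field k] : Set (ℕ → k) :=
  {q | ∃ a b : ℕ → k, IsRational a ∧ IsRational b ∧ (∀ n : ℕ, b n ≠ 0) ∧
    q = fun n => a n * (b n)⁻¹}

end RationalSeq

namespace RationalSeq

open Set in
theorem exists_algebraicIndependent_padicInt_lift (p : ℕ) [Fact p.Prime]
    {ι : Type*} [Fintype ι] (c : ι → ZMod p) :
    ∃ τ : ι → ℤ_[p], AlgebraicIndependent ℤ τ ∧ ∀ i, PadicInt.toZMod (τ i) = c i := by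
  revert c
  refine Fintype.induction_empty_option (P := fun ι _ => ∀ c : ι → ZMod p,
    ∃ τ : ι → ℤ_[p], AlgebraicIndependent ℤ τ ∧ ∀ i, PadicInt.toZMod (τ i) = c i) ?_ ?_ ?_ ι
  · intro α β _ e ih c
    obtain ⟨τ, hτ, h⟩ := ih (c ∘ e)
    exact ⟨τ ∘ e.symm, hτ.comp _ e.symm.injective, fun i => by simp [h]⟩
  · intro c
    exact ⟨isEmptyElim, algebraicIndependent_empty_type_iff.2
      (FaithfulSMul.algebraMap_injective ℤ ℤ_[p]), isEmptyElim⟩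
  · intro α _ ih c
    obtain ⟨τ, hτ, h⟩ := ih (c ∘ some)
    have hc : Countable (Algebra.adjoin ℤ (range τ)) :=
      have : Countable (MvPolynomial α ℤ) := by
        rw [← Cardinal.mk_le_aleph0_iff]
        exact MvPolynomial.cardinalMk_le_max_lift.trans (by simp)
      hτ.aevalEquiv.symm.injective.countable
    have hA : {x : ℤ_[p] | IsAlgebraic (Algebra.adjoin ℤ (range τ)) x}.Countable :=
      Algebraic.countable _ _
    obtain ⟨d, hd⟩ := ZMod.ringHom_surjective (PadicInt.toZMod (p := p)) (c none)
    have hU : ¬ (Metric.ball (d : ℚ_[p]) 1).Countable := by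
      intro hcount
      have h1 := continuum_le_cardinal_of_isOpen ℚ_[p]
        (Metric.isOpen_ball (x := (d : ℚ_[p])) (ε := 1)) ⟨_, Metric.mem_ball_self one_pos⟩
      exact (Cardinal.aleph0_lt_continuum.trans_le h1).not_ge (Cardinal.le_aleph0_iff_set_countable.2 hcount)
    obtain ⟨x, hx, hxA⟩ : ∃ x ∈ Metric.ball (d : ℚ_[p]) 1,
        x ∉ (fun y : ℤ_[p] => (y : ℚ_[p])) '' {x | IsAlgebraic (Algebra.adjoin ℤ (range τ)) x} := by
      by_contra! hcon
      exact hU ((hA.image _).mono hcon)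
    rw [Metric.mem_ball, dist_eq_norm] at hx
    have hx1 : ‖x‖ ≤ 1 := by
      have := Padic.nonarchimedean (x - (d : ℚ_[p])) d
      rw [sub_add_cancel] at this
      exact this.trans (max_le hx.le d.2)
    refine ⟨fun o => o.elim ⟨x, hx1⟩ τ, (hτ.option_iff_transcendental _).2
      fun halg => hxA ⟨_, halg, rfl⟩, ?_⟩
    rintro (_ | i)
    · rw [← hd, ← sub_eq_zero, ← map_sub, ← RingHom.mem_ker, PadicInt.ker_toZMod,
        IsLocalRing.mem_maximalIdeal, PadicInt.mem_nonunits]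
      exact hx
    · exact h i

/-- Elements of a field of characteristic zero can be made simultaneously integral in the algebraic
closure of some `ℚ_[p]`. -/
theorem exists_padic_embedding {k : Type*} [Field k] [CharZero k] (S : Finset k) :
    ∃ (p : ℕ) (_ : Fact p.Prime) (K : Subring k) (φ : K →+* PadicAlgCl p),
      Function.Injective φ ∧ ∀ s ∈ S, ∃ h : s ∈ K, ‖φ ⟨s, h⟩‖ ≤ 1 := by
  classical
  obtain ⟨B, hB⟩ := (AlgebraicIndependent.matroid ℤ k).exists_isBasis (S : Set k)
  rw [AlgebraicIndependent.matroid_isBasis_iff] at hB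
  obtain ⟨hind, hBS, halg⟩ := hB
  have : Fintype B := (S.finite_toSet.subset hBS).fintype
  have hind : AlgebraicIndependent ℤ (fun b : B => (b : k)) := hind
  let R := MvPolynomial B ℤ
  let a : R →+* k := (MvPolynomial.aeval (fun b : B => (b : k)) : R →ₐ[ℤ] k).toRingHom
  have ha : Function.Injective a := hind
  let : Algebra R k := a.toAlgebra
  have hRk : Function.Injective (algebraMap R k) := ha
  let K : Subalgebra R k := Subalgebra.algebraicClosure R k
  have hSK : ∀ s ∈ S, s ∈ K := by
    intro s hs
    change IsAlgebraic R s
    have h1 := halg s hs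
    rw [← Subtype.range_coe (s := B)] at h1
    exact IsAlgebraic.of_ringHom_of_comp_eq (hind.aevalEquiv : R →+* _) (RingHom.id k) h1
      hind.aevalEquiv.surjective Function.injective_id (RingHom.ext fun P => rfl)
  have hRK : Function.Injective (algebraMap R K) := fun x y h => hRk (congrArg Subtype.val h)
  have : FaithfulSMul R K := (faithfulSMul_iff_algebraMap_injective R K).2 hRK
  obtain ⟨D, hD, hint⟩ := Algebra.IsAlgebraic.exists_integral_multiples R
    (S.attach.image fun s : {x // x ∈ S} => (⟨s.1, hSK s.1 s.2⟩ : K))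
  obtain ⟨c, hc⟩ : ∃ c : B → ℤ, MvPolynomial.eval c D ≠ 0 := by
    by_contra! h
    exact hD (MvPolynomial.funext fun c => by simp [h c])
  obtain ⟨p, hpgt, hp⟩ := Nat.exists_infinite_primes ((MvPolynomial.eval c D).natAbs + 1)
  have : Fact p.Prime := ⟨hp⟩
  have hpD : ((MvPolynomial.eval c D : ℤ) : ZMod p) ≠ 0 := by
    rw [Ne, ZMod.intCast_zmod_eq_zero_iff_dvd]
    intro hdvd
    have := Int.natAbs_dvd_natAbs.2 hdvd
    have := Nat.le_of_dvd (Int.natAbs_pos.2 hc) this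
    simp at this
    omega
  obtain ⟨τ, hτ, hτc⟩ := exists_algebraicIndependent_padicInt_lift p fun b => ((c b : ℤ) : ZMod p)
  let f₀ : R →+* ℤ_[p] := (MvPolynomial.aeval τ : R →ₐ[ℤ] ℤ_[p]).toRingHom
  let g : ℤ_[p] →+* PadicAlgCl p := (algebraMap ℚ_[p] (PadicAlgCl p)).comp PadicInt.Coe.ringHom
  have hg (x) : ‖g x‖ = ‖x‖ := PadicAlgCl.norm_extends p (x : ℚ_[p])
  have hgi : Function.Injective g :=
    (algebraMap ℚ_[p] (PadicAlgCl p)).injective.comp Subtype.val_injective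
  let : Algebra R (PadicAlgCl p) := (g.comp f₀).toAlgebra
  have hRM : Function.Injective (algebraMap R (PadicAlgCl p)) := hgi.comp hτ
  have : FaithfulSMul R (PadicAlgCl p) := (faithfulSMul_iff_algebraMap_injective _ _).2 hRM
  let φ : K →ₐ[R] PadicAlgCl p := IsAlgClosed.lift
  have hDnorm : ‖algebraMap R (PadicAlgCl p) D‖ = 1 := by
    change ‖g (f₀ D)‖ = 1
    rw [hg, ← PadicInt.isUnit_iff]
    by_contra hnu
    have : f₀ D ∈ IsLocalRing.maximalIdeal ℤ_[p] := hnu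
    rw [← PadicInt.ker_toZMod, RingHom.mem_ker] at this
    apply hpD
    rw [← this]
    have : (Int.castRingHom (ZMod p)).comp (MvPolynomial.eval c) = PadicInt.toZMod.comp f₀ := by
      ext i
      · simp
      · simp [f₀, hτc]
    exact RingHom.congr_fun this D
  refine ⟨p, inferInstance, K.toSubring, φ.toRingHom, ?_, fun s hs => ⟨hSK s hs, ?_⟩⟩
  · rw [injective_iff_map_eq_zero]
    intro x hx
    by_contra hx0
    obtain ⟨r, hr, y, hy⟩ := (Algebra.IsAlgebraic.isAlgebraic (R := R) (show K from x)).exists_nonzero_dvd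
      (mem_nonZeroDivisors_of_ne_zero hx0)
    have h1 := congrArg φ hy
    have h2 : φ x = 0 := hx
    rw [AlgHom.commutes, map_mul, h2, zero_mul] at h1
    exact hr (hRM (h1.trans (map_zero _).symm))
  · have h1 := hint ⟨s, hSK s hs⟩ (by simpa using hs)
    have h2 : IsIntegral R (φ (D • (⟨s, hSK s hs⟩ : K))) := h1.map φ
    let v : Valuation (PadicAlgCl p) NNReal := Valued.v
    have hle (r : R) : algebraMap R (PadicAlgCl p) r ∈ v.integer := by
      change ‖g (f₀ r)‖ ≤ 1
      rw [hg]
      exact PadicInt.norm_le_one _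
    have h3 : IsIntegral v.integer (φ (D • (⟨s, hSK s hs⟩ : K))) := by
      obtain ⟨P, hP, hP0⟩ := h2
      refine ⟨P.map ((algebraMap R (PadicAlgCl p)).codRestrict v.integer hle), hP.map _, ?_⟩
      rw [Polynomial.eval₂_map]
      exact hP0
    have h4 : ‖φ (D • (⟨s, hSK s hs⟩ : K))‖ ≤ 1 := (Valuation.integer.integers v).mem_of_integral h3
    rw [map_smul, Algebra.smul_def, norm_mul, hDnorm, one_mul] at h4
    exact h4

end RationalSeq

namespace RationalSeq

open NormedSpace Filter Topology

theorem _root_.Units.exists_pow_mem_nhds_one {A : Type*} [NormedRing A] [ProperSpace A] (u : Aˣ)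
    {M : ℝ} (h₁ : ∀ n : ℕ, ‖((u ^ n : Aˣ) : A)‖ ≤ M) (h₂ : ∀ n : ℕ, ‖((u⁻¹ ^ n : Aˣ) : A)‖ ≤ M)
    {U : Set A} (hU : U ∈ 𝓝 1) : ∃ N : ℕ, 0 < N ∧ ((u ^ N : Aˣ) : A) ∈ U := by
  obtain ⟨a, -, φ, hφ, hlim⟩ := tendsto_subseq_of_bounded (x := fun n : ℕ => ((u ^ n : Aˣ) : A))
    (Metric.isBounded_closedBall (x := 0) (r := M)) (fun n => by simpa using h₁ n)
  have hdiff : Tendsto (fun i => ((u ^ φ (i + 1) : Aˣ) : A) - ((u ^ φ i : Aˣ) : A)) atTop (𝓝 0) := by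
    simpa using (hlim.comp (tendsto_add_atTop_nat 1)).sub hlim
  have hlim1 : Tendsto (fun i => ((u ^ (φ (i + 1) - φ i) : Aˣ) : A)) atTop (𝓝 1) := by
    rw [tendsto_iff_norm_sub_tendsto_zero]
    refine squeeze_zero (fun _ => norm_nonneg _) (fun i => ?_)
      (by simpa using hdiff.norm.const_mul M)
    have hle : φ i ≤ φ (i + 1) := hφ.monotone i.le_succ
    have : ((u ^ (φ (i + 1) - φ i) : Aˣ) : A) - 1 =
        ((u⁻¹ ^ φ i : Aˣ) : A) * (((u ^ φ (i + 1) : Aˣ) : A) - ((u ^ φ i : Aˣ) : A)) := by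
      have hu : u⁻¹ ^ φ i * u ^ φ (i + 1) = u ^ (φ (i + 1) - φ i) := by
        rw [inv_pow, inv_mul_eq_iff_eq_mul, ← pow_add, Nat.add_sub_of_le hle]
      rw [mul_sub, ← Units.val_mul, ← Units.val_mul, hu, inv_pow, inv_mul_cancel,
        Units.val_one]
    rw [this]
    exact (norm_mul_le _ _).trans (mul_le_mul_of_nonneg_right (h₂ _) (norm_nonneg _))
  obtain ⟨i, hi⟩ := (hlim1.eventually hU).exists
  exact ⟨_, Nat.sub_pos_of_lt (hφ i.lt_succ_self), hi⟩

theorem le_norm_padic_factorial (p : ℕ) [Fact p.Prime] (n : ℕ) :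
    ((p : ℝ) ^ n)⁻¹ ≤ ‖(n.factorial : ℚ_[p])‖ := by
  have h0 : (n.factorial : ℚ_[p]) ≠ 0 := by exact_mod_cast n.factorial_ne_zero
  have hp : 1 < p := (Fact.out : p.Prime).one_lt
  rw [Padic.norm_eq_zpow_neg_valuation h0, Padic.valuation_natCast, zpow_neg, zpow_natCast]
  have hv : padicValNat p n.factorial ≤ n := by
    have h1 := sub_one_mul_padicValNat_factorial (p := p) n
    have h2 : 1 * padicValNat p n.factorial ≤ (p - 1) * padicValNat p n.factorial :=
      Nat.mul_le_mul_right _ (by omega)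
    omega
  have hp' : (1 : ℝ) ≤ p := by exact_mod_cast hp.le
  gcongr

variable {E A : Type*} [NontriviallyNormedField E] [NormedRing A] [NormedAlgebra E A]

variable (E A) in
theorem expSeries_radius_pos_of_padic (p : ℕ) [Fact p.Prime] [NormedAlgebra ℚ_[p] E] :
    0 < (expSeries E A).radius := by
  have hp : 0 < p := (Fact.out : p.Prime).pos
  refine lt_of_lt_of_le ?_ ((expSeries E A).le_radius_of_bound (r := (p : NNReal)⁻¹)
    (max 1 ‖(1 : A)‖) fun n => ?_)
  · simp
  · have h1 : ‖expSeries E A n‖ ≤ (p : ℝ) ^ n * max 1 ‖(1 : A)‖ := by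
      rw [expSeries]
      refine (norm_smul_le (n.factorial⁻¹ : E)
        (ContinuousMultilinearMap.mkPiAlgebraFin E n A)).trans ?_
      rw [norm_inv]
      refine mul_le_mul ?_ ?_ (norm_nonneg _) (by positivity)
      · apply inv_le_of_inv_le₀ (by positivity)
        have := le_norm_padic_factorial p n
        rwa [← norm_algebraMap' E, map_natCast] at this
      · exact ContinuousMultilinearMap.norm_mkPiAlgebraFin_le
    have h0 : (p : ℝ) ≠ 0 := by positivity
    calc _ ≤ (p : ℝ) ^ n * max 1 ‖(1 : A)‖ * ((p : ℝ)⁻¹) ^ n := by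
          push_cast; gcongr
      _ = max 1 ‖(1 : A)‖ := by
          rw [mul_right_comm, ← mul_pow, mul_inv_cancel₀ h0, one_pow, one_mul]

theorem smul_mem_eball_expSeries {Λ : A} (hΛ : 2 * ‖Λ‖ₑ < (expSeries E A).radius)
    {x : E} (hx : ‖x‖ ≤ 2) : x • Λ ∈ Metric.eball (0 : A) (expSeries E A).radius := by
  rw [Metric.mem_eball, edist_zero_right]
  refine lt_of_le_of_lt ?_ hΛ
  refine (enorm_smul_le (r := x) (x := Λ)).trans ?_
  gcongr
  rw [← ofReal_norm]
  exact ENNReal.ofReal_le_of_le_toReal (by simpa using hx)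

variable [CharZero E] [CompleteSpace A]

theorem exp_natCast_smul_of_mem_ball {Λ : A}
    (h : ∀ n : ℕ, (n : E) • Λ ∈ Metric.eball (0 : A) (expSeries E A).radius) (n : ℕ) :
    exp ((n : E) • Λ) = exp Λ ^ n := by
  induction n with
  | zero => simp
  | succ n ih =>
    rw [Nat.cast_succ, add_smul, one_smul, exp_add_of_commute_of_mem_ball (𝕂 := E)
      ((Commute.refl Λ).smul_left _) (h n) (by simpa using h 1), ih, pow_succ]

/-- A `p`-adic analytic one-parameter group `x ↦ exp (x • Λ)`, tested against a linear functional,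
vanishes at all natural numbers as soon as it vanishes at infinitely many of them. -/
theorem exp_smul_eq_zero_of_infinite [ProperSpace E] (hE : ∀ n : ℕ, ‖(n : E)‖ ≤ 1) {Λ : A}
    (hΛ : 2 * ‖Λ‖ₑ < (expSeries E A).radius) (ℓ : A →L[E] E)
    (hinf : {n : ℕ | ℓ (exp ((n : E) • Λ)) = 0}.Infinite) (n : ℕ) :
    ℓ (exp ((n : E) • Λ)) = 0 := by
  obtain ⟨x₀, hx₀, hacc⟩ :=
    (hinf.image (Nat.cast_injective (R := E)).injOn).exists_accPt_of_subset_isCompact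
      (isCompact_closedBall (0 : E) 1) (by rintro _ ⟨n, -, rfl⟩; simpa using hE n)
  replace hx₀ : ‖x₀‖ ≤ 1 := by simpa using hx₀
  have hadd (y : E) (hy : ‖y‖ ≤ 2) :
      exp ((y + x₀) • Λ) = exp (y • Λ) * exp (x₀ • Λ) := by
    rw [add_smul, exp_add_of_commute_of_mem_ball (𝕂 := E)
      (((Commute.refl Λ).smul_left _).smul_right _) (smul_mem_eball_expSeries hΛ hy)
      (smul_mem_eball_expSeries hΛ (hx₀.trans one_le_two))]
  let u : E →L[E] A := ContinuousLinearMap.toSpanSingleton E Λ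
  let m : A →L[E] E := ℓ ∘L (ContinuousLinearMap.mul E A).flip (exp (x₀ • Λ))
  have hr : 0 < (expSeries E A).radius := pos_of_gt hΛ
  have hexp : HasFPowerSeriesOnBall (exp : A → A) (expSeries E A) (u 0) (expSeries E A).radius := by
    rw [map_zero]
    exact hasFPowerSeriesOnBall_exp_of_radius_pos hr
  have hg := m.comp_hasFPowerSeriesOnBall hexp.compContinuousLinearMap
  set q := m.compFormalMultilinearSeries ((expSeries E A).compContinuousLinearMap u)
  have hu : ‖u‖ₑ = ‖Λ‖ₑ := by
    rw [← ofReal_norm, ← ofReal_norm, ContinuousLinearMap.norm_toSpanSingleton]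
  have hrad (y : E) (hy : ‖y‖ ≤ 2) :
      y ∈ Metric.eball (0 : E) ((expSeries E A).radius / ‖u‖ₑ) := by
    rw [Metric.mem_eball, edist_zero_right, hu]
    have hy' : ‖y‖ₑ ≤ 2 := by
      rw [← ofReal_norm]
      exact ENNReal.ofReal_le_of_le_toReal (by simpa using hy)
    refine hy'.trans_lt ?_
    rw [ENNReal.lt_div_iff_mul_lt (by simp) (by simp)]
    exact hΛ
  have hval (y : E) (hy : ‖y‖ ≤ 2) : (⇑m ∘ exp ∘ u) y = ℓ (exp ((y + x₀) • Λ)) := by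
    simp [hadd y hy, m, u]
  have hzero : (⇑m ∘ exp ∘ u) =ᶠ[𝓝 0] 0 := by
    refine hg.analyticAt.eventually_eq_zero_or_eventually_ne_zero.resolve_right fun hne => ?_
    rw [accPt_iff_frequently] at hacc
    have hsub : Tendsto (fun z : E => z - x₀) (𝓝 x₀) (𝓝 0) :=
      tendsto_sub_nhds_zero_iff.2 tendsto_id
    rw [eventually_nhdsWithin_iff] at hne
    obtain ⟨_, ⟨hz, n, hn, rfl⟩, hne⟩ := (hacc.and_eventually (hsub.eventually hne)).exists
    refine hne (sub_ne_zero.2 hz) ?_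
    rwa [hval _ ((norm_sub_le _ _).trans (by linarith [hE n])), sub_add_cancel]
  have hq : q = 0 := hg.hasFPowerSeriesAt.eq_zero_of_eventually hzero
  have hn : ‖(n : E) - x₀‖ ≤ 2 := (norm_sub_le _ _).trans (by linarith [hE n])
  have := hg.hasSum (hrad _ hn)
  rw [zero_add, hval _ hn, sub_add_cancel, hq] at this
  exact this.unique (by simp)

/-- If the powers of a unit `u` of a finite-dimensional `p`-adic algebra are bounded, then for some
`N > 0`, every linear functional vanishing on infinitely many powers of `u ^ N` vanishes on all of
them. -/
theorem exists_pow_forall_eq_zero_of_infinite (p : ℕ) [Fact p.Prime] [NormedAlgebra ℚ_[p] E]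
    [ProperSpace E] [ProperSpace A] (u : Aˣ) {M : ℝ} (h₁ : ∀ n : ℕ, ‖((u ^ n : Aˣ) : A)‖ ≤ M)
    (h₂ : ∀ n : ℕ, ‖((u⁻¹ ^ n : Aˣ) : A)‖ ≤ M) :
    ∃ N : ℕ, 0 < N ∧ ∀ ℓ : A →L[E] E, {n : ℕ | ℓ ((u : A) ^ (N * n)) = 0}.Infinite →
      ∀ n : ℕ, ℓ ((u : A) ^ (N * n)) = 0 := by
  have hr := expSeries_radius_pos_of_padic E A p
  have hE (n : ℕ) : ‖(n : E)‖ ≤ 1 := by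
    rw [← map_natCast (algebraMap ℚ_[p] E), norm_algebraMap']
    exact_mod_cast Padic.norm_int_le_one (n : ℤ)
  have hsmall : {Λ : A | 2 * ‖Λ‖ₑ < (expSeries E A).radius} ∈ 𝓝 0 := by
    have : Continuous fun Λ : A => 2 * ‖Λ‖ₑ :=
      ENNReal.continuous_const_mul (by simp) |>.comp continuous_enorm
    exact this.continuousAt.eventually_lt continuousAt_const (by simpa using hr)
  have hmap : map (exp : A → A) (𝓝 0) = 𝓝 1 := by
    have h := hasStrictFDerivAt_exp_zero_of_radius_pos hr
    simpa using h.map_nhds_eq_of_equiv (f' := ContinuousLinearEquiv.refl E A)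
  obtain ⟨N, hN, Λ, hΛ, hexp⟩ := u.exists_pow_mem_nhds_one h₁ h₂ (hmap ▸ image_mem_map hsmall)
  have hpow (n : ℕ) : exp ((n : E) • Λ) = (u : A) ^ (N * n) := by
    rw [exp_natCast_smul_of_mem_ball (fun n => smul_mem_eball_expSeries hΛ
      ((hE n).trans one_le_two)), hexp, Units.val_pow_eq_pow_val, pow_mul]
  refine ⟨N, hN, fun ℓ hℓ n => ?_⟩
  simp only [← hpow] at hℓ ⊢
  exact exp_smul_eq_zero_of_infinite hE hΛ ℓ hℓ n

end RationalSeq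

namespace RationalSeq

open Matrix

section Ultrametric

attribute [local instance] Matrix.linftyOpNormedRing Matrix.linftyOpNormedAlgebra

variable {d : Type*} [Fintype d] [DecidableEq d]

theorem norm_matrix_pow_apply_le_one {E : Type*} [NormedField E] [IsUltrametricDist E]
    {A : Matrix d d E} (hA : ∀ i j, ‖A i j‖ ≤ 1) (n : ℕ) (i j : d) : ‖(A ^ n) i j‖ ≤ 1 := by
  induction n generalizing i j with
  | zero => rw [pow_zero, Matrix.one_apply]; split_ifs <;> simp
  | succ n ih =>
    rw [pow_succ, Matrix.mul_apply]
    refine IsUltrametricDist.norm_sum_le_of_forall_le_of_nonneg zero_le_one fun l _ => ?_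
    rw [norm_mul]
    exact mul_le_one₀ (ih i l) (norm_nonneg _) (hA l j)

theorem linftyOpNorm_le_card {E : Type*} [NormedField E] {A : Matrix d d E}
    (hA : ∀ i j, ‖A i j‖ ≤ 1) : ‖A‖ ≤ Fintype.card d := by
  rw [Matrix.linfty_opNorm_def, ← NNReal.coe_natCast, NNReal.coe_le_coe]
  refine Finset.sup_le fun i _ => ?_
  exact (Finset.sum_le_card_nsmul _ _ (1 : NNReal) fun j _ => hA i j).trans (by simp)

theorem exists_matrix_pow_forall_eq_zero_of_infinite (p : ℕ) [Fact p.Prime] {E : Type*}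
    [NormedField E] [IsUltrametricDist E] [NormedAlgebra ℚ_[p] E] [FiniteDimensional ℚ_[p] E]
    (u : (Matrix d d E)ˣ) (h₁ : ∀ i j, ‖(u : Matrix d d E) i j‖ ≤ 1)
    (h₂ : ∀ i j, ‖((u⁻¹ : (Matrix d d E)ˣ) : Matrix d d E) i j‖ ≤ 1) :
    ∃ N : ℕ, 0 < N ∧ ∀ v w : d → E,
      {n : ℕ | v ⬝ᵥ (((u : Matrix d d E) ^ (N * n)) *ᵥ w) = 0}.Infinite →
        ∀ n : ℕ, v ⬝ᵥ (((u : Matrix d d E) ^ (N * n)) *ᵥ w) = 0 := by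
  let _ : NontriviallyNormedField E := ⟨by
    obtain ⟨x, hx⟩ := NontriviallyNormedField.non_trivial (α := ℚ_[p])
    exact ⟨algebraMap _ E x, by rwa [norm_algebraMap']⟩⟩
  have : CharZero E := charZero_of_injective_algebraMap (algebraMap ℚ_[p] E).injective
  have : ProperSpace E := FiniteDimensional.proper ℚ_[p] E
  have : ProperSpace (Matrix d d E) := FiniteDimensional.proper E _
  obtain ⟨N, hN, h⟩ := exists_pow_forall_eq_zero_of_infinite (E := E) p u (M := Fintype.card d)
    (fun n => by
      rw [Units.val_pow_eq_pow_val]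
      exact linftyOpNorm_le_card (norm_matrix_pow_apply_le_one h₁ n))
    (fun n => by
      rw [Units.val_pow_eq_pow_val]
      exact linftyOpNorm_le_card (norm_matrix_pow_apply_le_one h₂ n))
  refine ⟨N, hN, fun v w => ?_⟩
  let ℓ : Matrix d d E →ₗ[E] E :=
    { toFun := fun M => v ⬝ᵥ (M *ᵥ w)
      map_add' := fun M M' => by rw [Matrix.add_mulVec, dotProduct_add]
      map_smul' := fun c M => by rw [Matrix.smul_mulVec, dotProduct_smul, RingHom.id_apply] }
  exact h (LinearMap.toContinuousLinearMap ℓ)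

end Ultrametric

/-- A variant of `exists_padic_embedding` with values in a finite extension of `ℚ_[p]`. -/
theorem exists_padic_embedding_finiteDimensional {k : Type*} [Field k] [CharZero k]
    (S : Finset k) :
    ∃ (p : ℕ) (_ : Fact p.Prime) (E : IntermediateField ℚ_[p] (PadicAlgCl p)) (R : Subring k)
      (φ : R →+* E), FiniteDimensional ℚ_[p] E ∧ Function.Injective φ ∧
        ∀ s ∈ S, ∃ h : s ∈ R, ‖φ ⟨s, h⟩‖ ≤ 1 := by
  obtain ⟨p, hp, K, φ, hφ, hS⟩ := exists_padic_embedding S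
  have hSK : Subring.closure (S : Set k) ≤ K := Subring.closure_le.2 fun s hs => (hS s hs).1
  let ψ := φ.comp (Subring.inclusion hSK)
  let g : S → PadicAlgCl p := fun s => φ ⟨s, (hS s s.2).1⟩
  let E := IntermediateField.adjoin ℚ_[p] (Set.range g)
  have hE (x) : ψ x ∈ E := by
    have hle : Subring.closure (S : Set k) ≤ (E.toSubring.comap ψ).map (Subring.subtype _) := by
      refine Subring.closure_le.2 fun s hs => ?_
      exact ⟨⟨s, Subring.subset_closure hs⟩,
        IntermediateField.subset_adjoin _ _ ⟨⟨s, hs⟩, rfl⟩, rfl⟩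
    obtain ⟨y, hy, hxy⟩ := hle x.2
    rwa [← Subtype.ext hxy]
  refine ⟨p, hp, E, Subring.closure S, ψ.codRestrict E hE,
    IntermediateField.finiteDimensional_adjoin fun x _ => Algebra.IsIntegral.isIntegral x,
    fun x y hxy => ?_, fun s hs => ⟨Subring.subset_closure hs, (hS s hs).2⟩⟩
  exact Subring.inclusion_injective hSK (hφ (congrArg Subtype.val hxy))

/-- The Skolem-Mahler-Lech theorem for the orbits of an invertible matrix: along suitable
arithmetic progressions, `v ⬝ᵥ A ^ n *ᵥ w` vanishes everywhere or at only finitely many places. -/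
theorem exists_forall_dotProduct_pow_mulVec_eq_zero {k : Type*} [Field k] [CharZero k]
    {d : Type*} [Fintype d] [DecidableEq d] (u : (Matrix d d k)ˣ) (v w : d → k) :
    ∃ N : ℕ, 0 < N ∧ ∀ r : ℕ,
      {n : ℕ | v ⬝ᵥ (((u : Matrix d d k) ^ (N * n + r)) *ᵥ w) = 0}.Infinite →
        ∀ n : ℕ, v ⬝ᵥ (((u : Matrix d d k) ^ (N * n + r)) *ᵥ w) = 0 := by
  classical
  obtain ⟨p, hp, E, R, φ, hfd, hφ, hS⟩ := exists_padic_embedding_finiteDimensional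
    (Finset.univ.image (fun ij : d × d => (u : Matrix d d k) ij.1 ij.2) ∪
      Finset.univ.image (fun ij : d × d => ((u⁻¹ : (Matrix d d k)ˣ) : Matrix d d k) ij.1 ij.2) ∪
      Finset.univ.image v ∪ Finset.univ.image w)
  choose A hA using fun i j => hS ((u : Matrix d d k) i j)
    (by simpa using Or.inl ⟨i, j, rfl⟩)
  choose B hB using fun i j => hS (((u⁻¹ : (Matrix d d k)ˣ) : Matrix d d k) i j)
    (by simpa using Or.inr (Or.inl ⟨i, j, rfl⟩))
  choose hv _ using fun i => hS (v i) (by simp)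
  choose hw _ using fun i => hS (w i) (by simp)
  let A' : Matrix d d R := fun i j => ⟨_, A i j⟩
  let B' : Matrix d d R := fun i j => ⟨_, B i j⟩
  let v' : d → R := fun i => ⟨_, hv i⟩
  let w' : d → R := fun i => ⟨_, hw i⟩
  have hinj : Function.Injective (R.subtype.mapMatrix (m := d)) :=
    Matrix.map_injective Subtype.val_injective
  have hA' : R.subtype.mapMatrix A' = (u : Matrix d d k) := rfl
  have hB' : R.subtype.mapMatrix B' = ((u⁻¹ : (Matrix d d k)ˣ) : Matrix d d k) := rfl
  let U : (Matrix d d R)ˣ :=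
    ⟨A', B', hinj (by rw [map_mul, hA', hB', map_one, Units.mul_inv]),
      hinj (by rw [map_mul, hA', hB', map_one, Units.inv_mul])⟩
  obtain ⟨N, hN, h⟩ := exists_matrix_pow_forall_eq_zero_of_infinite p
    (Units.map (φ.mapMatrix (m := d)).toMonoidHom U) hA hB
  have hk (n : ℕ) : R.subtype (v' ⬝ᵥ ((A' ^ n) *ᵥ w')) = v ⬝ᵥ (((u : Matrix d d k) ^ n) *ᵥ w) := by
    rw [RingHom.map_dotProduct, ← hA', ← map_pow]
    congr 1
    funext i
    exact RingHom.map_mulVec _ _ _ _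
  have hpE (n : ℕ) : φ (v' ⬝ᵥ ((A' ^ n) *ᵥ w')) = (φ ∘ v') ⬝ᵥ (((φ.mapMatrix A') ^ n) *ᵥ (φ ∘ w')) := by
    rw [RingHom.map_dotProduct, ← map_pow]
    congr 1
    funext i
    exact RingHom.map_mulVec _ _ _ _
  have key (n : ℕ) : v ⬝ᵥ (((u : Matrix d d k) ^ n) *ᵥ w) = 0 ↔
      (φ ∘ v') ⬝ᵥ (((φ.mapMatrix A') ^ n) *ᵥ (φ ∘ w')) = 0 := by
    rw [← hk, ← hpE, map_eq_zero_iff _ Subtype.val_injective, map_eq_zero_iff _ hφ]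
  refine ⟨N, hN, fun r => ?_⟩
  simp_rw [key, pow_add, ← Matrix.mulVec_mulVec]
  exact h _ _

end RationalSeq

namespace RationalSeq

open Polynomial

section Shift

variable {k : Type*} [Field k]

variable (k) in
/-- The shift operator on sequences, as an endomorphism of the pointwise algebra. -/
def shift : (ℕ → k) →ₐ[k] (ℕ → k) where
  toFun a n := a (n + 1)
  map_one' := rfl
  map_mul' _ _ := rfl
  map_zero' := rfl
  map_add' _ _ := rfl
  commutes' _ := rfl

theorem shift_pow_apply (m : ℕ) (a : ℕ → k) (n : ℕ) :
    ((shift k).toLinearMap ^ m) a n = a (n + m) := by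
  induction m generalizing n with
  | zero => rfl
  | succ m ih =>
    rw [pow_succ', Module.End.mul_apply]
    exact (ih (n + 1)).trans (congrArg a (by omega))

theorem coeff_mk_mul_reflect (a : ℕ → k) {D : ℕ} {f : k[X]} (hf : f.natDegree ≤ D) (n : ℕ) :
    PowerSeries.coeff (n + D) (PowerSeries.mk a * ((reflect D f : k[X]) : PowerSeries k)) =
      aeval (shift k).toLinearMap f a n := by
  refine induction_with_natDegree_le (fun f => PowerSeries.coeff (n + D)
    (PowerSeries.mk a * ((reflect D f : k[X]) : PowerSeries k)) =
      aeval (shift k).toLinearMap f a n) D (by simp) (fun i c _ hi => ?_)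
    (fun f g _ _ hf hg => ?_) f hf
  · rw [reflect_C_mul_X_pow, revAt_le hi, Polynomial.coe_mul, Polynomial.coe_C, Polynomial.coe_pow,
      Polynomial.coe_X, show n + D = n + i + (D - i) by omega, ← mul_assoc,
      PowerSeries.coeff_mul_X_pow, mul_comm, PowerSeries.coeff_C_mul, PowerSeries.coeff_mk]
    simp [shift_pow_apply, Module.algebraMap_end_apply]
  · rw [reflect_add, Polynomial.coe_add, mul_add, map_add, hf, hg, map_add, LinearMap.add_apply,
      Pi.add_apply]

theorem isRational_iff_exists_monic {a : ℕ → k} :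
    IsRational a ↔ ∃ f : k[X], f.Monic ∧ aeval (shift k).toLinearMap f a = 0 := by
  constructor
  · rintro ⟨P, Q, hQ, h⟩
    set D := max (P.natDegree + 1) Q.natDegree
    have hD : (reflect D Q).natDegree ≤ D :=
      natDegree_reflect_le.trans (max_le le_rfl (le_max_right _ _))
    refine ⟨reflect D Q, ?_, ?_⟩
    · refine monic_of_natDegree_le_of_coeff_eq_one D hD ?_
      rw [coeff_reflect, revAt_le le_rfl, Nat.sub_self, hQ]
    · funext n
      rw [← coeff_mk_mul_reflect a hD, reflect_reflect, h, Polynomial.coeff_coe]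
      exact coeff_eq_zero_of_natDegree_lt (by omega)
  · rintro ⟨f, hf, h⟩
    refine ⟨PowerSeries.trunc f.natDegree (PowerSeries.mk a * ((reflect f.natDegree f : k[X]) : PowerSeries k)),
      reflect f.natDegree f, ?_, ?_⟩
    · rw [coeff_reflect, revAt_le (zero_le), Nat.sub_zero, hf.coeff_natDegree]
    · ext n
      rw [Polynomial.coeff_coe, PowerSeries.coeff_trunc]
      split_ifs with hn
      · rfl
      · obtain ⟨m, rfl⟩ := Nat.exists_eq_add_of_le' (not_lt.1 hn)
        rw [coeff_mk_mul_reflect a le_rfl, h, Pi.zero_apply]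

theorem exists_submodule_of_monic {a : ℕ → k} {f : k[X]} (hf : f.Monic)
    (h : aeval (shift k).toLinearMap f a = 0) :
    ∃ V : Submodule k (ℕ → k), V.FG ∧ V.map (shift k).toLinearMap ≤ V ∧ a ∈ V ∧
      ∀ x ∈ V, aeval (shift k).toLinearMap f x = 0 := by
  let T : k[X] →ₗ[k] (ℕ → k) :=
    (LinearMap.applyₗ a).comp (aeval (shift k).toLinearMap).toLinearMap
  have hT (g : k[X]) : T g = aeval (shift k).toLinearMap g a := rfl
  have hrange : LinearMap.range T = (degreeLT k f.natDegree).map T := by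
    refine le_antisymm ?_ LinearMap.map_le_range
    rintro _ ⟨g, rfl⟩
    refine ⟨g %ₘ f, ?_, ?_⟩
    · rw [SetLike.mem_coe, mem_degreeLT, ← degree_eq_natDegree hf.ne_zero]
      exact degree_modByMonic_lt _ hf
    · conv_rhs => rw [← modByMonic_add_div g f]
      rw [map_add, hT (f * _), mul_comm, map_mul, Module.End.mul_apply, h, map_zero, add_zero]
  refine ⟨LinearMap.range T, ?_, ?_, ⟨1, by simp [hT]⟩, ?_⟩
  · rw [hrange]
    exact Submodule.FG.map _ (Module.Finite.iff_fg.1 inferInstance)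
  · rintro _ ⟨_, ⟨g, rfl⟩, rfl⟩
    exact ⟨X * g, by rw [hT, map_mul, aeval_X]; rfl⟩
  · rintro _ ⟨g, rfl⟩
    rw [hT, ← Module.End.mul_apply, ← map_mul, mul_comm, map_mul, Module.End.mul_apply, h, map_zero]

theorem isRational_of_mem {a : ℕ → k} {V : Submodule k (ℕ → k)} (hfg : V.FG)
    (hV : V.map (shift k).toLinearMap ≤ V) (ha : a ∈ V) : IsRational a := by
  have : Module.Finite k V := Module.Finite.iff_fg.2 hfg
  have hV' : ∀ x ∈ V, (shift k).toLinearMap x ∈ V := fun x hx => hV ⟨x, hx, rfl⟩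
  let T : Module.End k V := (shift k).toLinearMap.restrict hV'
  refine isRational_iff_exists_monic.2 ⟨T.charpoly, T.charpoly_monic, ?_⟩
  have hTn (n : ℕ) (x : V) : ((T ^ n) x : ℕ → k) = ((shift k).toLinearMap ^ n) x := by
    rw [Module.End.pow_restrict, LinearMap.coe_restrict_apply]
  have key (g : k[X]) (x : V) : aeval (shift k).toLinearMap g (x : ℕ → k) = aeval T g x := by
    induction g using Polynomial.induction_on' generalizing x with
    | add p q hp hq => simp [hp, hq]
    | monomial n c =>
      rw [← C_mul_X_pow_eq_monomial]
      simp [hTn, Module.algebraMap_end_apply]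
  rw [key T.charpoly ⟨a, ha⟩, LinearMap.aeval_self_charpoly]
  rfl

theorem isRational_iff_exists_submodule {a : ℕ → k} :
    IsRational a ↔ ∃ V : Submodule k (ℕ → k), V.FG ∧ V.map (shift k).toLinearMap ≤ V ∧ a ∈ V := by
  refine ⟨fun h => ?_, fun ⟨V, hfg, hV, ha⟩ => isRational_of_mem hfg hV ha⟩
  obtain ⟨f, hf, h⟩ := isRational_iff_exists_monic.1 h
  obtain ⟨V, hfg, hV, ha, -⟩ := exists_submodule_of_monic hf h
  exact ⟨V, hfg, hV, ha⟩

theorem IsRational.add {a b : ℕ → k} (ha : IsRational a) (hb : IsRational b) :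
    IsRational (a + b) := by
  obtain ⟨V, hVf, hV, ha⟩ := isRational_iff_exists_submodule.1 ha
  obtain ⟨W, hWf, hW, hb⟩ := isRational_iff_exists_submodule.1 hb
  refine isRational_of_mem (hVf.sup hWf) ?_ (Submodule.add_mem_sup ha hb)
  rw [Submodule.map_sup]
  exact sup_le_sup hV hW

theorem IsRational.mul {a b : ℕ → k} (ha : IsRational a) (hb : IsRational b) :
    IsRational (a * b) := by
  obtain ⟨V, hVf, hV, ha⟩ := isRational_iff_exists_submodule.1 ha
  obtain ⟨W, hWf, hW, hb⟩ := isRational_iff_exists_submodule.1 hb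
  refine isRational_of_mem (hVf.mul hWf) ?_ (Submodule.mul_mem_mul ha hb)
  rw [Submodule.map_mul]
  exact mul_le_mul' hV hW

theorem IsRational.neg {a : ℕ → k} (ha : IsRational a) : IsRational (-a) := by
  obtain ⟨V, hVf, hV, ha⟩ := isRational_iff_exists_submodule.1 ha
  exact isRational_of_mem hVf hV (neg_mem ha)

theorem isRational_zero : IsRational (0 : ℕ → k) :=
  isRational_iff_exists_monic.2 ⟨1, monic_one, map_zero _⟩

/-- Ultimately periodic sequences are rational. -/
theorem isRational_of_eventually_periodic_s16 {a : ℕ → k} {M N : ℕ} (hN : 0 < N)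
    (h : ∀ n, M ≤ n → a (n + N) = a n) : IsRational a := by
  refine isRational_iff_exists_monic.2
    ⟨X ^ M * (X ^ N - 1), (monic_X_pow M).mul (monic_X_pow_sub_C 1 hN.ne'), ?_⟩
  funext n
  simp only [map_mul, map_sub, map_pow, aeval_X, map_one, Module.End.mul_apply, shift_pow_apply,
    LinearMap.sub_apply, Module.End.one_apply, Pi.sub_apply, Pi.zero_apply]
  rw [h _ (by omega), sub_self]

theorem isRational_one : IsRational (1 : ℕ → k) :=
  isRational_of_eventually_periodic_s16 (M := 0) one_pos fun _ _ => rfl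

theorem IsRational.exists_dotProduct_pow_mulVec {a : ℕ → k} (ha : IsRational a) :
    ∃ (m d : ℕ) (u : (Matrix (Fin d) (Fin d) k)ˣ) (v w : Fin d → k), ∀ n,
      a (n + m) = v ⬝ᵥ (((u : Matrix (Fin d) (Fin d) k) ^ n).mulVec w) := by
  obtain ⟨f, hf, h⟩ := isRational_iff_exists_monic.1 ha
  obtain ⟨g, hfg, hg⟩ := exists_eq_pow_rootMultiplicity_mul_and_not_dvd f hf.ne_zero 0
  set m := f.rootMultiplicity 0
  rw [C_0, sub_zero] at hfg hg
  have hgm : g.Monic := (monic_X_pow m).of_mul_monic_left (hfg ▸ hf)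
  have hg0 : g.coeff 0 ≠ 0 := fun h0 => hg (X_dvd_iff.2 h0)
  set b := ((shift k).toLinearMap ^ m) a
  have hb : aeval (shift k).toLinearMap g b = 0 := by
    rw [hfg, mul_comm, map_mul, map_pow, aeval_X] at h
    exact h
  obtain ⟨V, hVf, hV, hbV, hgV⟩ := exists_submodule_of_monic hgm hb
  have : Module.Finite k V := Module.Finite.iff_fg.2 hVf
  have hV' : ∀ x ∈ V, (shift k).toLinearMap x ∈ V := fun x hx => hV ⟨x, hx, rfl⟩
  let T : Module.End k V := (shift k).toLinearMap.restrict hV'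
  have hT : IsUnit T := by
    rw [LinearMap.isUnit_iff_ker_eq_bot, LinearMap.ker_eq_bot']
    intro x hx
    have h1 := hgV x x.2
    rw [← divX_mul_X_add g, map_add, map_mul, aeval_X, LinearMap.add_apply, Module.End.mul_apply,
      show (shift k).toLinearMap x = 0 from congrArg Subtype.val hx, map_zero, zero_add, aeval_C,
      Module.algebraMap_end_apply, smul_eq_zero] at h1
    exact Subtype.ext (h1.resolve_left hg0)
  have hTn (n : ℕ) (x : V) : ((T ^ n) x : ℕ → k) = ((shift k).toLinearMap ^ n) x := by
    rw [Module.End.pow_restrict, LinearMap.coe_restrict_apply]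
  let B := Module.finBasis k V
  let ev : V →ₗ[k] k := (LinearMap.proj 0).comp V.subtype
  refine ⟨m, _, Units.map (LinearMap.toMatrixAlgEquiv B).toMulEquiv.toMonoidHom hT.unit,
    fun i => ev (B i), B.repr ⟨b, hbV⟩, fun n => ?_⟩
  have h1 : a (n + m) = ev ((T ^ n) ⟨b, hbV⟩) := by
    simp [ev, hTn, b, shift_pow_apply]
  have h2 (x : V) : ev x = (fun i => ev (B i)) ⬝ᵥ B.repr x := by
    conv_lhs => rw [← B.sum_repr x, map_sum]
    simp only [map_smul, smul_eq_mul, dotProduct, mul_comm]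
  rw [h1, h2, ← LinearMap.toMatrix_mulVec_repr B B]
  congr 2
  exact map_pow (LinearMap.toMatrixAlgEquiv B) T n

variable (k) in
/-- The quotients of rational sequences by pointwise nonvanishing ones form a subring. -/
def quotientSubring : Subring (ℕ → k) where
  carrier := Qset k
  mul_mem' := by
    rintro _ _ ⟨a, b, ha, hb, hb0, rfl⟩ ⟨c, d, hc, hd, hd0, rfl⟩
    refine ⟨a * c, b * d, ha.mul hc, hb.mul hd, fun n => mul_ne_zero (hb0 n) (hd0 n), ?_⟩
    funext n
    simp only [Pi.mul_apply, mul_inv]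
    ring
  one_mem' := by
    exact ⟨1, 1, isRational_one, isRational_one, fun _ => one_ne_zero, by funext; simp⟩
  add_mem' := by
    rintro _ _ ⟨a, b, ha, hb, hb0, rfl⟩ ⟨c, d, hc, hd, hd0, rfl⟩
    refine ⟨a * d + c * b, b * d, (ha.mul hd).add (hc.mul hb), hb.mul hd,
      fun n => mul_ne_zero (hb0 n) (hd0 n), ?_⟩
    funext n
    have := hb0 n
    have := hd0 n
    simp only [Pi.add_apply, Pi.mul_apply]
    field_simp
  zero_mem' := by
    exact ⟨0, 1, isRational_zero, isRational_one, fun _ => one_ne_zero, by funext; simp⟩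
  neg_mem' := by
    rintro _ ⟨a, b, ha, hb, hb0, rfl⟩
    exact ⟨-a, b, ha.neg, hb, hb0, by funext; simp⟩

end Shift

/-- The Skolem-Mahler-Lech theorem, in the form: the zero set of a rational sequence is ultimately
periodic. -/
theorem IsRational.exists_eventually_periodic_zero {k : Type*} [Field k] [CharZero k] {a : ℕ → k}
    (ha : IsRational a) : ∃ M N : ℕ, 0 < N ∧ ∀ n, M ≤ n → (a (n + N) = 0 ↔ a n = 0) := by
  obtain ⟨m, d, u, v, w, h⟩ := ha.exists_dotProduct_pow_mulVec
  obtain ⟨N, hN, hu⟩ := exists_forall_dotProduct_pow_mulVec_eq_zero u v w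
  simp only [← h] at hu
  have hr (r : ℕ) : ∃ M, (∀ n, a (N * n + r + m) = 0) ∨ ∀ n, M ≤ n → a (N * n + r + m) ≠ 0 := by
    by_cases hinf : {n : ℕ | a (N * n + r + m) = 0}.Infinite
    · exact ⟨0, Or.inl (hu r hinf)⟩
    · obtain ⟨M, hM⟩ := (Set.not_infinite.1 hinf).bddAbove
      exact ⟨M + 1, Or.inr fun n hn h0 => absurd (hM h0) (by omega)⟩
  choose M hM using hr
  let M₀ := (Finset.range N).sup M
  refine ⟨N * M₀ + m, N, hN, fun n hn => ?_⟩
  obtain ⟨l, rfl⟩ := Nat.exists_eq_add_of_le' ((Nat.le_add_left _ _).trans hn)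
  have hl : N * (l / N) + l % N = l := Nat.div_add_mod l N
  have hle : M (l % N) ≤ l / N :=
    (Finset.le_sup (f := M) (Finset.mem_range.2 (Nat.mod_lt l hN))).trans
      ((Nat.le_div_iff_mul_le hN).2 (by rw [mul_comm]; exact Nat.le_of_add_le_add_right hn))
  have e1 : l + m = N * (l / N) + l % N + m := by rw [hl]
  have e2 : l + m + N = N * (l / N + 1) + l % N + m := by rw [mul_add, mul_one]; omega
  rw [e2, e1]
  rcases hM (l % N) with h0 | h0
  · simp only [h0]
  · simp only [h0 _ hle, h0 _ (hle.trans (Nat.le_succ _))]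

open Classical in
theorem IsRational.indicator_zero {k : Type*} [Field k] [CharZero k] {a : ℕ → k}
    (ha : IsRational a) : IsRational fun n => if a n = 0 then (1 : k) else 0 := by
  obtain ⟨M, N, hN, h⟩ := ha.exists_eventually_periodic_zero
  exact isRational_of_eventually_periodic_s16 (M := M) hN fun n hn => by simp only [h n hn]

end RationalSeq

open RationalSeq in
/-- Lemma 6.11 of the paper: `𝓠 = {a·b⁻¹ : a, b rational, b pointwise nonzero}` is a von
Neumann regular subring of the pointwise ring `ℕ → k`, and it is the smallest von Neumann
regular subring containing the ring `𝓡°` of rational sequences. -/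
theorem stmt16 {k : Type*} [Field k] [CharZero k] :
    ∃ S : Subring (ℕ → k),
      (S : Set (ℕ → k)) = Qset k ∧
      (∀ q ∈ S, ∃ q' ∈ S, q * q' * q = q) ∧
      ∀ T : Subring (ℕ → k), (∀ t ∈ T, ∃ t' ∈ T, t * t' * t = t) →
        (∀ a : ℕ → k, IsRational a → a ∈ T) → S ≤ T := by
  classical
  refine ⟨quotientSubring k, rfl, ?_, ?_⟩
  · rintro _ ⟨a, b, ha, hb, hb0, rfl⟩
    refine ⟨_, ⟨b, a + fun n => if a n = 0 then 1 else 0, hb, ha.add ha.indicator_zero,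
      fun n => ?_, rfl⟩, ?_⟩
    · by_cases h : a n = 0 <;> simp [h]
    · funext n
      have := hb0 n
      by_cases h : a n = 0
      · simp [h]
      · simp only [Pi.mul_apply, Pi.add_apply, h, if_false, add_zero]
        field_simp
  · rintro T hT hR _ ⟨a, b, ha, hb, hb0, rfl⟩
    obtain ⟨b', hb', h⟩ := hT b (hR b hb)
    have : (fun n => a n * (b n)⁻¹) = a * b' := by
      funext n
      have h' : b n * b' n * b n = b n := congrFun h n
      have := hb0 n
      have h1 : b n * b' n = 1 := mul_right_cancel₀ this (by rw [h', one_mul])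
      rw [Pi.mul_apply, eq_inv_of_mul_eq_one_right h1]
    rw [this]
    exact T.mul_mem (hR a ha) hb'
end
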